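/- If N > 5040 is a 7-free integer (no prime p satisfies p^7 ∣ N), then σ(N) < e^γ · N · log log N, i.e., Robin's inequality holds for N. -/

import Mathlib

open Finset Filter

/-- Generalized Dedekind psi function `Ψ_t(n) = n ∏_{p ∣ n} (1 + 1/p + ⋯ + 1/p^(t-1))`. -/
noncomputable def Psi (t n : ℕ) : ℝ :=
  (n : ℝ) * ∏ p ∈ n.primeFactors, ∑ i ∈ Finset.range t, (1 : ℝ) / (p : ℝ) ^ i

/-- The primorial `N_n = ∏_{k=1}^n p_k`, the product of the first `n` primes. -/
noncomputable def primorialAt (n : ℕ) : ℕ := ∏ k ∈ Finset.range n, Nat.nth Nat.Prime k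

/-- The `n`-th prime `p_n` (so `nthPrime 1 = 2`). -/
noncomputable def nthPrime (n : ℕ) : ℕ := Nat.nth Nat.Prime (n - 1)

/-- The ratio `R_t(x) = Ψ_t(x) / (x log log x)`. -/
noncomputable def Rt (t n : ℕ) : ℝ := Psi t n / ((n : ℝ) * Real.log (Real.log n))

/-- The Riemann zeta value `ζ(t) = ∑_{n ≥ 1} n^{-t}` at an integer argument. -/
noncomputable def zetaNat (t : ℕ) : ℝ := ∑' k : ℕ, 1 / ((k : ℝ) + 1) ^ t

namespace Robin

open ArithmeticFunction (vonMangoldt vonMangoldt_nonneg)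

/-- The real harmonic number `1 + 1/2 + ⋯ + 1/m`. -/
noncomputable def harm (m : ℕ) : ℝ := ∑ j ∈ Ioc 0 m, (1 : ℝ) / j

theorem harm_succ (m : ℕ) : harm (m + 1) = harm m + 1 / ((m : ℝ) + 1) := by
  rw [harm, Finset.sum_Ioc_succ_top (Nat.zero_le m), harm]
  push_cast
  rfl

theorem harm_eq_harmonic (m : ℕ) : harm m = harmonic m := by
  induction m with
  | zero => simp [harm]
  | succ k ih =>
    rw [harm_succ, harmonic_succ, ih]
    push_cast
    rw [one_div]

theorem tendsto_harm_sub_log :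
    Tendsto (fun n : ℕ => harm n - Real.log n) atTop (nhds Real.eulerMascheroniConstant) := by
  simpa only [harm_eq_harmonic] using Real.tendsto_harmonic_sub_log

theorem log_le_half_sub_inv {y : ℝ} (hy : 1 ≤ y) : Real.log y ≤ (y - y⁻¹) / 2 := by
  rw [← Real.sinh_log (by linarith)]
  exact Real.self_le_sinh_iff.2 (Real.log_nonneg hy)

theorem two_div_le_log_succ_sub {m : ℝ} (hm : 0 < m) :
    2 / (2 * m + 1) ≤ Real.log (m + 1) - Real.log m := by
  have h := Real.le_log_one_add_of_nonneg (x := 1 / m) (by positivity)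
  rw [← Real.log_div (by positivity) (by positivity)]
  convert h using 1
  · field_simp
    ring
  · congr 1
    field_simp

theorem log_succ_sub_le {m : ℝ} (hm : 0 < m) :
    Real.log (m + 1) - Real.log m ≤ (1 / m + 1 / (m + 1)) / 2 := by
  have h := log_le_half_sub_inv (y := (m + 1) / m) (by rw [le_div_iff₀ hm]; linarith)
  rw [← Real.log_div (by positivity) (by positivity)]
  refine h.trans (le_of_eq ?_)
  field_simp
  ring

theorem le_of_monotone_of_tendsto_shift {f : ℕ → ℝ} {a : ℝ}
    (hf : ∀ m, 1 ≤ m → f m ≤ f (m + 1)) (ha : Tendsto f atTop (nhds a)) {m : ℕ} (hm : 1 ≤ m) :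
    f m ≤ a := by
  refine ge_of_tendsto ha ?_
  filter_upwards [eventually_ge_atTop m] with n hn
  induction n, hn using Nat.le_induction with
  | base => exact le_rfl
  | succ k hk ih => exact ih.trans (hf k (hm.trans hk))

theorem harm_le {m : ℕ} (hm : 1 ≤ m) :
    harm m ≤ Real.eulerMascheroniConstant + Real.log m + 1 / (2 * m) := by
  have key := le_of_monotone_of_tendsto_shift
    (f := fun n : ℕ => harm n - Real.log n - 1 / 2 * (1 / (n : ℝ)))
    (a := Real.eulerMascheroniConstant) ?_ ?_ hm
  · have : 1 / (2 * (m : ℝ)) = 1 / 2 * (1 / (m : ℝ)) := by rw [one_div_mul_one_div]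
    linarith
  · intro n hn
    have hn' : (0 : ℝ) < n := by exact_mod_cast hn
    have := log_succ_sub_le hn'
    simp only [harm_succ]
    push_cast
    linarith
  · have := tendsto_harm_sub_log.sub
      ((tendsto_one_div_atTop_nhds_zero_nat (𝕜 := ℝ)).const_mul (1 / 2))
    rwa [mul_zero, sub_zero] at this

theorem le_harm {m : ℕ} (hm : 1 ≤ m) :
    Real.eulerMascheroniConstant + Real.log m + 1 / (2 * m) - 1 / (8 * (m : ℝ) ^ 2) ≤ harm m := by
  have key := le_of_monotone_of_tendsto_shift
    (f := fun n : ℕ => -(harm n - Real.log n - 1 / 2 * (1 / (n : ℝ))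
      + 1 / 8 * (1 / (n : ℝ) * (1 / (n : ℝ)))))
    (a := -Real.eulerMascheroniConstant) ?_ ?_ hm
  · have h1 : 1 / (2 * (m : ℝ)) = 1 / 2 * (1 / (m : ℝ)) := by rw [one_div_mul_one_div]
    have h2 : 1 / (8 * (m : ℝ) ^ 2) = 1 / 8 * (1 / (m : ℝ) * (1 / (m : ℝ))) := by
      rw [one_div_mul_one_div, one_div_mul_one_div, sq]
    linarith
  · intro n hn
    have hn' : (0 : ℝ) < n := by exact_mod_cast hn
    have := two_div_le_log_succ_sub hn'
    have h3 : 1 / 2 * (1 / (n : ℝ)) - 1 / 8 * (1 / (n : ℝ) * (1 / (n : ℝ))) + 1 / 2 * (1 / ((n : ℝ) + 1))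
        + 1 / 8 * (1 / ((n : ℝ) + 1) * (1 / ((n : ℝ) + 1))) ≤ 2 / (2 * n + 1) := by
      rw [← sub_nonneg]
      have : 2 / (2 * (n : ℝ) + 1) - (1 / 2 * (1 / (n : ℝ)) - 1 / 8 * (1 / (n : ℝ) * (1 / (n : ℝ)))
        + 1 / 2 * (1 / ((n : ℝ) + 1)) + 1 / 8 * (1 / ((n : ℝ) + 1) * (1 / ((n : ℝ) + 1))))
        = 1 / (8 * (2 * (n : ℝ) + 1) * n ^ 2 * (n + 1) ^ 2) := by
        field_simp
        ring
      rw [this]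
      positivity
    simp only [harm_succ]
    push_cast
    linarith
  · have h0 := tendsto_one_div_atTop_nhds_zero_nat (𝕜 := ℝ)
    have := ((tendsto_harm_sub_log.sub (h0.const_mul (1 / 2))).add
      ((h0.mul h0).const_mul (1 / 8))).neg
    rwa [mul_zero, mul_zero, mul_zero, sub_zero, add_zero] at this

/-- `∑_{j ≤ u} (u / j - 1)`. -/
noncomputable def hyp (u : ℝ) : ℝ := ∑ j ∈ Ioc 0 ⌊u⌋₊, (u / j - 1)

theorem hyp_eq (u : ℝ) : hyp u = u * harm ⌊u⌋₊ - ⌊u⌋₊ := by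
  rw [hyp, harm, Finset.sum_sub_distrib, Finset.mul_sum]
  simp [div_eq_mul_inv]

theorem abs_hyp_sub_le {u : ℝ} (hu : 1 ≤ u) :
    |hyp u - (u * Real.log u + (Real.eulerMascheroniConstant - 1) * u + 1 / 2)|
      ≤ 1 / (4 * ⌊u⌋₊) := by
  have hm : 1 ≤ ⌊u⌋₊ := (Nat.one_le_floor_iff u).2 hu
  have hfl : (⌊u⌋₊ : ℝ) ≤ u := Nat.floor_le (by linarith)
  have hfu : u < (⌊u⌋₊ : ℝ) + 1 := Nat.lt_floor_add_one u
  have h1 := harm_le hm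
  have h2 := le_harm hm
  rw [hyp_eq]
  generalize ⌊u⌋₊ = n at *
  have hm1 : (1 : ℝ) ≤ n := by exact_mod_cast hm
  generalize harm n = h at *
  generalize (n : ℝ) = m at *
  generalize Real.eulerMascheroniConstant = g at *
  have hl : 2 * (u - m) / (m + u) ≤ Real.log u - Real.log m := by
    have := Real.le_log_one_add_of_nonneg (x := (u - m) / m) (div_nonneg (by linarith) (by linarith))
    have e : 1 + (u - m) / m = u / m := by field_simp; ring
    rw [e, Real.log_div (by linarith) (by linarith)] at this
    have e2 : (u - m) / m + 2 = (m + u) / m := by field_simp; ring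
    rw [e2] at this
    convert this using 1
    field_simp
  have hl2 : Real.log u - Real.log m ≤ (u / m - m / u) / 2 := by
    have := log_le_half_sub_inv (y := u / m) (by rw [le_div_iff₀ (by linarith)]; linarith)
    rwa [Real.log_div (by linarith) (by linarith), inv_div] at this
  have hu0 : 0 ≤ u := by linarith
  rw [abs_le]
  constructor
  · have a1 := mul_le_mul_of_nonneg_left h2 hu0
    have a2 := mul_le_mul_of_nonneg_left hl2 hu0
    have a3 : u * ((u / m - m / u) / 2) = (u ^ 2 / m - m) / 2 := by field_simp
    have a4 : u * (1 / (2 * m) - 1 / (8 * m ^ 2)) - (u ^ 2 / m - m) / 2 + u - m - 1 / 2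
        + 1 / (4 * m) = ((u - m) * (1 - (u - m)) * (4 * m) + (2 * m - u)) / (8 * m ^ 2) := by
      field_simp
      ring
    have a5 : 0 ≤ ((u - m) * (1 - (u - m)) * (4 * m) + (2 * m - u)) / (8 * m ^ 2) := by
      apply div_nonneg _ (by positivity)
      have : 0 ≤ (u - m) * (1 - (u - m)) := mul_nonneg (by linarith) (by linarith)
      nlinarith
    linarith
  · have a1 := mul_le_mul_of_nonneg_left h1 hu0
    have a2 := mul_le_mul_of_nonneg_left hl hu0
    have a4 : 1 / (4 * m) - (u * (1 / (2 * m)) - u * (2 * (u - m) / (m + u)) + u - m - 1 / 2)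
        = ((m + u) * (1 - 2 * (u - m)) + 4 * m * (u - m) ^ 2) / (4 * m * (m + u)) := by
      field_simp
      ring
    have a5 : 0 ≤ ((m + u) * (1 - 2 * (u - m)) + 4 * m * (u - m) ^ 2) / (4 * m * (m + u)) := by
      apply div_nonneg _ (by positivity)
      obtain ⟨f, rfl⟩ : ∃ f, u = m + f := ⟨u - m, by ring⟩
      nlinarith [sq_nonneg (f - 1 / 2)]
    linarith

theorem inv_succ_le_log_succ_sub {m : ℝ} (hm : 0 < m) :
    1 / (m + 1) ≤ Real.log (m + 1) - Real.log m := by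
  refine le_trans ?_ (two_div_le_log_succ_sub hm)
  rw [div_le_div_iff₀ (by linarith) (by linarith)]
  linarith

theorem log_sub_log_le {x y : ℝ} (hx : 0 < x) (hy : 0 < y) :
    Real.log y - Real.log x ≤ (y - x) / x := by
  rw [← Real.log_div hy.ne' hx.ne']
  refine (Real.log_le_sub_one_of_pos (div_pos hy hx)).trans (le_of_eq ?_)
  field_simp

/-- `log (m!)` as a sum. -/
noncomputable def logFact (m : ℕ) : ℝ := ∑ j ∈ Ioc 0 m, Real.log j

theorem logFact_succ (m : ℕ) : logFact (m + 1) = logFact m + Real.log ((m : ℝ) + 1) := by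
  rw [logFact, Finset.sum_Ioc_succ_top (Nat.zero_le m), logFact]
  push_cast
  rfl

theorem logFact_bounds {m : ℕ} (hm : 1 ≤ m) :
    m * Real.log m - m + 1 ≤ logFact m ∧
      logFact m ≤ m * Real.log m - m + 1 + Real.log m := by
  induction m, hm using Nat.le_induction with
  | base => simp [logFact]
  | succ k hk ih =>
    have hk' : (0 : ℝ) < k := by exact_mod_cast hk
    have h1 := log_sub_log_le hk' (show (0 : ℝ) < k + 1 by linarith)
    have h2 := inv_succ_le_log_succ_sub hk'
    rw [logFact_succ]
    push_cast
    have h3 : (k : ℝ) * (Real.log (k + 1) - Real.log k) ≤ 1 := by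
      refine (mul_le_mul_of_nonneg_left h1 hk'.le).trans (le_of_eq ?_)
      field_simp
      ring
    have h4 : 1 ≤ ((k : ℝ) + 1) * (Real.log (k + 1) - Real.log k) := by
      refine le_trans (le_of_eq ?_) (mul_le_mul_of_nonneg_left h2 (by linarith))
      field_simp
    constructor <;> nlinarith [ih.1, ih.2]

/-- `∑_{j ≤ m} log j / j`. -/
noncomputable def logHarm (m : ℕ) : ℝ := ∑ j ∈ Ioc 0 m, Real.log j / j

theorem logHarm_succ (m : ℕ) :
    logHarm (m + 1) = logHarm m + Real.log ((m : ℝ) + 1) / ((m : ℝ) + 1) := by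
  rw [logHarm, Finset.sum_Ioc_succ_top (Nat.zero_le m), logHarm]
  push_cast
  rfl

theorem five_fourths_le_log {m : ℝ} (hm : 4 ≤ m) : 5 / 4 ≤ Real.log m := by
  have h : Real.log 4 = 2 * Real.log 2 := by
    rw [show (4 : ℝ) = 2 ^ 2 by norm_num, Real.log_pow]
    norm_num
  have := Real.log_le_log (by norm_num) hm
  have := Real.log_two_gt_d9
  linarith

theorem logHarm_step {m : ℝ} (hm : 4 ≤ m) :
    Real.log (m + 1) / (m + 1) ≤ (Real.log (m + 1) ^ 2 - Real.log m ^ 2) / 2 ∧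
      (Real.log (m + 1) ^ 2 - Real.log m ^ 2) / 2 ≤ Real.log m / m := by
  have hm0 : 0 < m := by linarith
  have h1 := log_succ_sub_le hm0
  have h2 := two_div_le_log_succ_sub hm0
  have h3 := log_sub_log_le hm0 (show 0 < m + 1 by linarith)
  have h4 := five_fourths_le_log hm
  have h5 := five_fourths_le_log (show 4 ≤ m + 1 by linarith)
  have h6 : (m + 1 - m) / m = 1 / m := by ring
  have h7 : 1 / m ≤ 1 / 4 := one_div_le_one_div_of_le (by norm_num) hm
  rw [h6] at h3
  generalize Real.log (m + 1) = b at *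
  generalize Real.log m = a at *
  constructor
  · have : 2 / (2 * m + 1) * ((2 * b - 1 / m) / 2) ≤ (b - a) * ((b + a) / 2) :=
      mul_le_mul h2 (by linarith) (by linarith) (le_trans (by positivity) h2)
    refine le_trans ?_ (this.trans (le_of_eq (by ring)))
    rw [← sub_nonneg]
    have : 2 / (2 * m + 1) * ((2 * b - 1 / m) / 2) - b / (m + 1)
      = (b - (1 + 1 / m)) / ((2 * m + 1) * (m + 1)) := by
      field_simp
      ring
    rw [this]
    apply div_nonneg _ (by positivity)
    linarith
  · have : (b - a) * ((b + a) / 2) ≤ ((1 / m + 1 / (m + 1)) / 2) * ((2 * a + 1 / m) / 2) :=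
      mul_le_mul h1 (by linarith) (by linarith) (by positivity)
    refine le_trans (le_of_eq (by ring)) (this.trans ?_)
    rw [← sub_nonneg]
    have : a / m - (1 / m + 1 / (m + 1)) / 2 * ((2 * a + 1 / m) / 2)
      = (a - (1 + 1 / m / 2)) / (2 * m * (m + 1)) := by
      field_simp
      ring
    rw [this]
    apply div_nonneg _ (by positivity)
    linarith

theorem exists_logHarm_const :
    ∃ C : ℝ, ∀ m : ℕ, 4 ≤ m → Real.log m ^ 2 / 2 + C ≤ logHarm m ∧
      logHarm m ≤ Real.log m ^ 2 / 2 + C + Real.log m / m := by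
  let a : ℕ → ℝ := fun m => logHarm m - Real.log m ^ 2 / 2
  let b : ℕ → ℝ := fun m => a m - Real.log m / m
  have ha : ∀ m n, 4 ≤ m → m ≤ n → a n ≤ a m := by
    intro m n hm hmn
    induction n, hmn using Nat.le_induction with
    | base => exact le_rfl
    | succ k hk ih =>
      refine le_trans ?_ ih
      have h4 : (4 : ℝ) ≤ k := by exact_mod_cast hm.trans hk
      have := (logHarm_step h4).1
      simp only [a, logHarm_succ]
      push_cast
      linarith
  have hb : ∀ m n, 4 ≤ m → m ≤ n → b m ≤ b n := by
    intro m n hm hmn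
    induction n, hmn using Nat.le_induction with
    | base => exact le_rfl
    | succ k hk ih =>
      refine ih.trans ?_
      have h4 : (4 : ℝ) ≤ k := by exact_mod_cast hm.trans hk
      have := (logHarm_step h4).2
      simp only [a, b, logHarm_succ]
      push_cast
      linarith
  have hba : ∀ m, 4 ≤ m → b m ≤ a m := by
    intro m hm
    have : 0 ≤ Real.log m / m :=
      div_nonneg (Real.log_nonneg (by exact_mod_cast (by omega : 1 ≤ m))) (by positivity)
    simp only [b]
    linarith
  have hab : ∀ m n, 4 ≤ m → 4 ≤ n → b m ≤ a n := fun m n hm hn =>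
    ((hb m (max m n) hm (le_max_left _ _)).trans
      (hba _ (hm.trans (le_max_left _ _)))).trans (ha n _ hn (le_max_right _ _))
  refine ⟨sSup (b '' Set.Ici 4), fun m hm => ?_⟩
  have h1 : b m ≤ sSup (b '' Set.Ici 4) := by
    refine le_csSup ⟨a 4, ?_⟩ ⟨m, hm, rfl⟩
    rintro _ ⟨k, hk, rfl⟩
    exact hab k 4 hk le_rfl
  have h2 : sSup (b '' Set.Ici 4) ≤ a m := by
    refine csSup_le ⟨b 4, 4, Set.self_mem_Ici, rfl⟩ ?_
    rintro _ ⟨k, hk, rfl⟩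
    exact hab k m hk hm
  simp only [a, b] at h1 h2 ⊢
  constructor <;> linarith

/-- `∑_{j ≤ y} log j (y / j - 1)`. -/
noncomputable def logHyp (y : ℝ) : ℝ := ∑ j ∈ Ioc 0 ⌊y⌋₊, Real.log j * (y / j - 1)

theorem logHyp_eq (y : ℝ) : logHyp y = y * logHarm ⌊y⌋₊ - logFact ⌊y⌋₊ := by
  rw [logHyp, logHarm, logFact, Finset.mul_sum, ← Finset.sum_sub_distrib]
  refine Finset.sum_congr rfl fun j _ => ?_
  ring

theorem exists_logHyp_const :
    ∃ C : ℝ, ∀ y : ℝ, 4 ≤ y →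
      |logHyp y - y * (Real.log y ^ 2 / 2 - Real.log y + C)| ≤ 1 + 3 * Real.log y := by
  obtain ⟨C, hC⟩ := exists_logHarm_const
  refine ⟨C + 1, fun y hy => ?_⟩
  have hm : 4 ≤ ⌊y⌋₊ := Nat.le_floor (by exact_mod_cast hy)
  have hfl : (⌊y⌋₊ : ℝ) ≤ y := Nat.floor_le (by linarith)
  have hfu : y < (⌊y⌋₊ : ℝ) + 1 := Nat.lt_floor_add_one y
  obtain ⟨h1, h2⟩ := hC _ hm
  obtain ⟨h3, h4⟩ := logFact_bounds (m := ⌊y⌋₊) (by omega)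
  rw [logHyp_eq]
  generalize ⌊y⌋₊ = n at *
  have hn : (4 : ℝ) ≤ n := by exact_mod_cast hm
  generalize (n : ℝ) = m at *
  generalize logHarm n = S at *
  generalize logFact n = F at *
  have hm0 : 0 < m := by linarith
  have hy0 : 0 < y := by linarith
  have d1 : Real.log m ≤ Real.log y := Real.log_le_log hm0 hfl
  have d2 := log_sub_log_le hm0 hy0
  have d3 := log_sub_log_le hy0 hm0
  have e1 := five_fourths_le_log hn
  have hle : y / m ≤ 5 / 4 := by
    rw [div_le_iff₀ hm0]
    linarith
  generalize Real.log m = a at *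
  generalize Real.log y = b at *
  have d2' : y * (b - a) ≤ 5 / 4 := by
    have := mul_le_mul_of_nonneg_left d2 hy0.le
    have h5 : y * ((y - m) / m) = y / m * (y - m) := by ring
    nlinarith
  have d4 : m * (b - a) ≤ y - m := by
    rw [le_div_iff₀ hm0] at d2
    linarith
  have d5 : y - m ≤ y * (b - a) := by
    have : -(y * (b - a)) ≤ m - y := by
      rw [le_div_iff₀ hy0] at d3
      linarith
    linarith
  have s1 : y * (b ^ 2 / 2 - a ^ 2 / 2) ≤ 5 / 4 * b := by
    have : y * (b ^ 2 / 2 - a ^ 2 / 2) = y * (b - a) * ((b + a) / 2) := by ring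
    rw [this]
    exact mul_le_mul d2' (by linarith) (by linarith) (by norm_num)
  have s0 : 0 ≤ y * (b ^ 2 / 2 - a ^ 2 / 2) := by
    have : y * (b ^ 2 / 2 - a ^ 2 / 2) = y * (b - a) * ((b + a) / 2) := by ring
    rw [this]
    exact mul_nonneg (mul_nonneg hy0.le (by linarith)) (by linarith)
  have s2 : y * (a / m) ≤ 5 / 4 * b := by
    have : y * (a / m) = y / m * a := by ring
    rw [this]
    exact mul_le_mul hle d1 (by linarith) (by norm_num)
  have t1 := mul_le_mul_of_nonneg_left h1 hy0.le
  have t2 := mul_le_mul_of_nonneg_left h2 hy0.le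
  have u1 : 0 ≤ (y * b - y) - (m * a - m) := by nlinarith
  have u2 : (y * b - y) - (m * a - m) ≤ b := by nlinarith
  rw [abs_le]
  constructor <;> linarith

theorem hyp_eq_zero {u : ℝ} (hu : u < 1) : hyp u = 0 := by
  rw [hyp, Nat.floor_eq_zero.2 hu]
  simp

theorem sum_mul_log_eq {f : ℕ → ℝ} (N : ℕ) :
    ∑ m ∈ Ioc 0 N, Real.log m * f m
      = ∑ n ∈ Ioc 0 N, vonMangoldt n * ∑ j ∈ Ioc 0 (N / n), f (n * j) := by
  simp_rw [Finset.mul_sum, ← ArithmeticFunction.vonMangoldt_sum, Finset.sum_mul]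
  rw [Finset.sum_sigma', Finset.sum_sigma']
  refine Finset.sum_bij' (fun x _ => ⟨x.2, x.1 / x.2⟩) (fun x _ => ⟨x.1 * x.2, x.1⟩) ?_ ?_ ?_ ?_ ?_
  · rintro ⟨m, d⟩ h
    simp only [mem_sigma, mem_Ioc, Nat.mem_divisors] at h ⊢
    obtain ⟨⟨h1, h2⟩, ⟨k, rfl⟩, h4⟩ := h
    have hd : 0 < d := Nat.pos_of_mul_pos_right h1
    have hk : 0 < k := Nat.pos_of_mul_pos_left h1
    rw [Nat.mul_div_cancel_left _ hd]
    refine ⟨⟨hd, (Nat.le_mul_of_pos_right d hk).trans h2⟩, hk, ?_⟩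
    rw [Nat.le_div_iff_mul_le hd, mul_comm]
    exact h2
  · rintro ⟨n, j⟩ h
    simp only [mem_sigma, mem_Ioc, Nat.mem_divisors] at h ⊢
    obtain ⟨⟨h1, h2⟩, h3, h4⟩ := h
    refine ⟨⟨Nat.mul_pos h1 h3, ?_⟩, Dvd.intro _ rfl, (Nat.mul_pos h1 h3).ne'⟩
    rw [Nat.le_div_iff_mul_le h1, mul_comm] at h4
    exact h4
  · rintro ⟨m, d⟩ h
    simp only [mem_sigma, mem_Ioc, Nat.mem_divisors] at h
    simp [Nat.mul_div_cancel' h.2.1]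
  · rintro ⟨n, j⟩ h
    simp only [mem_sigma, mem_Ioc] at h
    simp [Nat.mul_div_cancel_left _ h.1.1]
  · rintro ⟨m, d⟩ h
    simp only [mem_sigma, mem_Ioc, Nat.mem_divisors] at h
    simp [Nat.mul_div_cancel' h.2.1]

theorem logHyp_eq_sum_hyp {y t : ℝ} (hyt : y ≤ t) (hy : 0 ≤ y) :
    logHyp y = ∑ n ∈ Ioc 0 ⌊t⌋₊, vonMangoldt n * hyp (y / n) := by
  have hsub : Ioc 0 ⌊y⌋₊ ⊆ Ioc 0 ⌊t⌋₊ := Ioc_subset_Ioc le_rfl (Nat.floor_mono hyt)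
  rw [logHyp, sum_mul_log_eq (f := fun m => y / m - 1), ← Finset.sum_subset hsub]
  · refine Finset.sum_congr rfl fun n _ => ?_
    rw [hyp, Nat.floor_div_natCast]
    congr 1
    refine Finset.sum_congr rfl fun j _ => ?_
    push_cast
    rw [div_div]
  · intro n hn hn'
    simp only [mem_Ioc, not_and, not_le] at hn hn'
    have := (Nat.floor_lt hy).1 (hn' hn.1)
    have hn0 : (0 : ℝ) < n := by exact_mod_cast hn.1
    rw [hyp_eq_zero ((div_lt_one hn0).2 this), mul_zero]

/-- `∑_{n ≤ t} Λ(n) (t / n - 1)`. -/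
noncomputable def mangoldtHyp (t : ℝ) : ℝ := ∑ n ∈ Ioc 0 ⌊t⌋₊, vonMangoldt n * (t / n - 1)

theorem affine_le {p q a b u hi : ℝ} (hau : a ≤ u) (hub : u ≤ b)
    (ha : p * a + q ≤ hi) (hb : p * b + q ≤ hi) : p * u + q ≤ hi := by
  rcases le_total 0 p with hp | hp
  · nlinarith
  · nlinarith

theorem le_affine {p q a b u lo : ℝ} (hau : a ≤ u) (hub : u ≤ b)
    (ha : lo ≤ p * a + q) (hb : lo ≤ p * b + q) : lo ≤ p * u + q := by
  rcases le_total 0 p with hp | hp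
  · nlinarith
  · nlinarith

/-- The coefficient of `hyp (u / 5)` in the smoothing combination. -/
noncomputable def coefFive : ℝ :=
  5 * (1 - Real.log 2 - Real.log 3 / 3) / (3 * Real.log 2 - Real.log 5)

/-- The coefficient of `hyp (u / 8)` in the smoothing combination. -/
noncomputable def coefEight : ℝ := -(4 / 3) - 8 * coefFive / 5

theorem coefFive_bounds : -(6315 / 10000) ≤ coefFive ∧ coefFive ≤ -(6313 / 10000) := by
  have h1 := Real.log_two_gt_d9
  have h2 := Real.log_two_lt_d9
  have h3 := Real.log_three_gt_d9
  have h4 := Real.log_three_lt_d9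
  have h5 := Real.log_five_gt_d9
  have h6 := Real.log_five_lt_d9
  have : 0 < 3 * Real.log 2 - Real.log 5 := by linarith
  constructor
  · rw [coefFive, le_div_iff₀ this]
    linarith
  · rw [coefFive, div_le_iff₀ this]
    linarith

theorem coefFive_mul : coefFive * (3 * Real.log 2 - Real.log 5)
    = 5 * (1 - Real.log 2 - Real.log 3 / 3) := by
  have h1 := Real.log_two_gt_d9
  have h6 := Real.log_five_lt_d9
  rw [coefFive, div_mul_cancel₀]
  linarith

/-- The slope of the smoothing error on `[m, m + 1]`, with parameter `c`. -/
def smoothSlope (m : ℕ) (c : ℚ) : ℚ :=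
  harmonic m - harmonic (m / 2) / 2 - harmonic (m / 3) / 3 + c / 5 * harmonic (m / 5)
    - (1 / 6 + c / 5) * harmonic (m / 8) - 1

/-- The constant term of the smoothing error on `[m, m + 1]`, with parameter `c`. -/
def smoothConst (m : ℕ) (c : ℚ) : ℚ :=
  -m + (m / 2 : ℕ) + (m / 3 : ℕ) - c * (m / 5 : ℕ) + (4 / 3 + 8 * c / 5) * (m / 8 : ℕ) + 1

/-- The smoothing error. -/
noncomputable def smoothErr (u : ℝ) : ℝ :=
  hyp u - hyp (u / 2) - hyp (u / 3) + coefFive * hyp (u / 5) + coefEight * hyp (u / 8) - (u - 1)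

theorem smoothErr_eq {u : ℝ} {m : ℕ} (hm : ⌊u⌋₊ = m) :
    smoothErr u = (harm m - harm (m / 2) / 2 - harm (m / 3) / 3 + coefFive / 5 * harm (m / 5)
    - (1 / 6 + coefFive / 5) * harm (m / 8) - 1) * u + (-m + (m / 2 : ℕ) + (m / 3 : ℕ)
      - coefFive * (m / 5 : ℕ) + (4 / 3 + 8 * coefFive / 5) * (m / 8 : ℕ) + 1) := by
  have h2 : ⌊u / 2⌋₊ = m / 2 := by
    rw [← hm, ← Nat.floor_div_natCast]
    norm_num
  have h3 : ⌊u / 3⌋₊ = m / 3 := by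
    rw [← hm, ← Nat.floor_div_natCast]
    norm_num
  have h5 : ⌊u / 5⌋₊ = m / 5 := by
    rw [← hm, ← Nat.floor_div_natCast]
    norm_num
  have h8 : ⌊u / 8⌋₊ = m / 8 := by
    rw [← hm, ← Nat.floor_div_natCast]
    norm_num
  simp only [smoothErr, hyp_eq, h2, h3, h5, h8, hm, coefEight]
  ring

theorem smoothErr_eq_zero {u : ℝ} (h1 : 1 ≤ u) (h5 : u < 5) : smoothErr u = 0 := by
  have hfu := (Nat.floor_lt (n := 5) (by linarith : 0 ≤ u)).2 (by exact_mod_cast h5)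
  have hfl := (Nat.one_le_floor_iff u).2 h1
  rw [smoothErr_eq rfl]
  generalize ⌊u⌋₊ = m at *
  have e0 : harm 0 = 0 := by simp [harm]
  have e1 : harm 1 = 1 := by simp [harm]
  have e2 : harm 2 = 3 / 2 := by rw [harm_succ, e1]; norm_num
  have e3 : harm 3 = 11 / 6 := by rw [harm_succ, e2]; norm_num
  have e4 : harm 4 = 25 / 12 := by rw [harm_succ, e3]; norm_num
  interval_cases m <;> norm_num [e0, e1, e2, e3, e4]

theorem smooth_check : ∀ m ∈ Finset.Ico 5 100, ∀ e ∈ Finset.range 2, ∀ f ∈ Finset.range 2,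
    -(20 / 1000 : ℚ) ≤ smoothSlope m (-(6313 + 2 * f) / 10000) * (m + e)
        + smoothConst m (-(6313 + 2 * f) / 10000) ∧
    smoothSlope m (-(6313 + 2 * f) / 10000) * (m + e)
        + smoothConst m (-(6313 + 2 * f) / 10000) ≤ 75 / 1000 := by
  decide +kernel

theorem smoothErr_bounds_of_lt {u : ℝ} (h5 : 5 ≤ u) (h100 : u < 100) :
    -(20 / 1000) ≤ smoothErr u ∧ smoothErr u ≤ 75 / 1000 := by
  have hm5 : 5 ≤ ⌊u⌋₊ := Nat.le_floor (by exact_mod_cast h5)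
  have hm100 : ⌊u⌋₊ < 100 := (Nat.floor_lt (by linarith)).2 (by exact_mod_cast h100)
  have hfl : (⌊u⌋₊ : ℝ) ≤ u := Nat.floor_le (by linarith)
  have hfu : u ≤ (⌊u⌋₊ : ℝ) + 1 := (Nat.lt_floor_add_one u).le
  rw [smoothErr_eq rfl]
  have hcheck := smooth_check ⌊u⌋₊ (Finset.mem_Ico.2 ⟨hm5, hm100⟩)
  generalize ⌊u⌋₊ = m at *
  have key : ∀ e ∈ Finset.range 2, -(20 / 1000) ≤
      ((harm (m / 5) / 5 - harm (m / 8) / 5) * (m + e) - (m / 5 : ℕ) + 8 / 5 * (m / 8 : ℕ))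
        * coefFive + ((harm m - harm (m / 2) / 2 - harm (m / 3) / 3 - 1 / 6 * harm (m / 8) - 1)
          * (m + e) - m + (m / 2 : ℕ) + (m / 3 : ℕ) + 4 / 3 * (m / 8 : ℕ) + 1) ∧
      ((harm (m / 5) / 5 - harm (m / 8) / 5) * (m + e) - (m / 5 : ℕ) + 8 / 5 * (m / 8 : ℕ))
        * coefFive + ((harm m - harm (m / 2) / 2 - harm (m / 3) / 3 - 1 / 6 * harm (m / 8) - 1)
          * (m + e) - m + (m / 2 : ℕ) + (m / 3 : ℕ) + 4 / 3 * (m / 8 : ℕ) + 1) ≤ 75 / 1000 := by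
    intro e he
    obtain ⟨l0, u0⟩ := hcheck e he 0 (by simp)
    obtain ⟨l1, u1⟩ := hcheck e he 1 (by simp)
    have l0' := (Rat.cast_le (K := ℝ)).2 l0
    have u0' := (Rat.cast_le (K := ℝ)).2 u0
    have l1' := (Rat.cast_le (K := ℝ)).2 l1
    have u1' := (Rat.cast_le (K := ℝ)).2 u1
    simp only [smoothSlope, smoothConst] at l0' u0' l1' u1'
    push_cast [← harm_eq_harmonic] at l0' u0' l1' u1'
    obtain ⟨c1, c2⟩ := coefFive_bounds
    exact ⟨le_affine c1 c2 (by linarith) (by linarith),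
      affine_le c1 c2 (by linarith) (by linarith)⟩
  obtain ⟨l0, u0⟩ := key 0 (by simp)
  obtain ⟨l1, u1⟩ := key 1 (by simp)
  push_cast at l0 u0 l1 u1
  rw [add_zero] at l0 u0
  exact ⟨le_affine hfl hfu (by linarith) (by linarith),
    affine_le hfl hfu (by linarith) (by linarith)⟩

theorem abs_hyp_div_sub_le {u : ℝ} {k m : ℕ} (hk : 1 ≤ k) (hm : 1 ≤ m) (hu : (k : ℝ) * m ≤ u) :
    |hyp (u / k) - (u / k * (Real.log u - Real.log k)
      + (Real.eulerMascheroniConstant - 1) * (u / k) + 1 / 2)| ≤ 1 / (4 * m) := by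
  have hk0 : (0 : ℝ) < k := by exact_mod_cast hk
  have hm0 : (1 : ℝ) ≤ m := by exact_mod_cast hm
  have hu0 : 0 < u := by nlinarith
  have hmu : (m : ℝ) ≤ u / k := by
    rw [le_div_iff₀ hk0]
    linarith
  rw [← Real.log_div hu0.ne' hk0.ne']
  refine (abs_hyp_sub_le (hm0.trans hmu)).trans ?_
  have : (m : ℝ) ≤ ⌊u / k⌋₊ := by exact_mod_cast Nat.le_floor hmu
  exact one_div_le_one_div_of_le (by linarith) (by linarith)

theorem coef_log_sum : -(Real.log 2 / 2) - Real.log 3 / 3 + coefFive * (Real.log 5 / 5)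
    + coefEight * (3 * Real.log 2 / 8) = -1 := by
  rw [coefEight]
  linear_combination (-1 / 5) * coefFive_mul

theorem log_eight : Real.log 8 = 3 * Real.log 2 := by
  rw [show (8 : ℝ) = 2 ^ 3 by norm_num, Real.log_pow]
  norm_num

theorem smoothErr_bounds_of_ge {u : ℝ} (hu : 100 ≤ u) :
    -(20 / 1000) ≤ smoothErr u ∧ smoothErr u ≤ 75 / 1000 := by
  have h1 := abs_le.1 (abs_hyp_div_sub_le (u := u) (k := 1) (m := 100) (by norm_num) (by norm_num)
    (by push_cast; linarith))
  have h2 := abs_le.1 (abs_hyp_div_sub_le (u := u) (k := 2) (m := 50) (by norm_num) (by norm_num)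
    (by push_cast; linarith))
  have h3 := abs_le.1 (abs_hyp_div_sub_le (u := u) (k := 3) (m := 33) (by norm_num) (by norm_num)
    (by push_cast; linarith))
  have h5 := abs_le.1 (abs_hyp_div_sub_le (u := u) (k := 5) (m := 20) (by norm_num) (by norm_num)
    (by push_cast; linarith))
  have h8 := abs_le.1 (abs_hyp_div_sub_le (u := u) (k := 8) (m := 12) (by norm_num) (by norm_num)
    (by push_cast; linarith))
  have hc := coef_log_sum
  have hc8 : coefEight = -(4 / 3) - 8 * coefFive / 5 := rfl
  obtain ⟨c1, c2⟩ := coefFive_bounds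
  push_cast [log_eight] at h1 h2 h3 h5 h8
  rw [Real.log_one, div_one] at h1
  have key : smoothErr u = 1 + (-1 + coefFive + coefEight) / 2
      + (hyp u - (u * (Real.log u - 0) + (Real.eulerMascheroniConstant - 1) * u + 1 / 2))
      - (hyp (u / 2) - (u / 2 * (Real.log u - Real.log 2)
        + (Real.eulerMascheroniConstant - 1) * (u / 2) + 1 / 2))
      - (hyp (u / 3) - (u / 3 * (Real.log u - Real.log 3)
        + (Real.eulerMascheroniConstant - 1) * (u / 3) + 1 / 2))
      + coefFive * (hyp (u / 5) - (u / 5 * (Real.log u - Real.log 5)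
        + (Real.eulerMascheroniConstant - 1) * (u / 5) + 1 / 2))
      + coefEight * (hyp (u / 8) - (u / 8 * (Real.log u - 3 * Real.log 2)
        + (Real.eulerMascheroniConstant - 1) * (u / 8) + 1 / 2)) := by
    rw [smoothErr]
    linear_combination (-u) * hc + (u / 8 * (Real.log u + Real.eulerMascheroniConstant - 1)) * hc8
  generalize hyp u - (u * (Real.log u - 0) + (Real.eulerMascheroniConstant - 1) * u + 1 / 2)
    = e1 at *
  generalize hyp (u / 2) - (u / 2 * (Real.log u - Real.log 2)
        + (Real.eulerMascheroniConstant - 1) * (u / 2) + 1 / 2) = e2 at *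
  generalize hyp (u / 3) - (u / 3 * (Real.log u - Real.log 3)
        + (Real.eulerMascheroniConstant - 1) * (u / 3) + 1 / 2) = e3 at *
  generalize hyp (u / 5) - (u / 5 * (Real.log u - Real.log 5)
        + (Real.eulerMascheroniConstant - 1) * (u / 5) + 1 / 2) = e5 at *
  generalize hyp (u / 8) - (u / 8 * (Real.log u - 3 * Real.log 2)
        + (Real.eulerMascheroniConstant - 1) * (u / 8) + 1 / 2) = e8 at *
  norm_num at h1 h2 h3 h5 h8
  have q5 : |coefFive * e5| ≤ 6315 / 10000 * (1 / 80) := by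
    rw [abs_mul]
    exact mul_le_mul (abs_le.2 ⟨by linarith, by linarith⟩) (abs_le.2 ⟨by linarith, by linarith⟩)
      (abs_nonneg _) (by norm_num)
  have q8 : |coefEight * e8| ≤ 3234 / 10000 * (1 / 48) := by
    rw [abs_mul]
    exact mul_le_mul (abs_le.2 ⟨by linarith, by linarith⟩) (abs_le.2 ⟨by linarith, by linarith⟩)
      (abs_nonneg _) (by norm_num)
  rw [abs_le] at q5 q8
  rw [key]
  constructor <;> linarith

theorem smoothErr_bounds {u : ℝ} (h5 : 5 ≤ u) :
    -(20 / 1000) ≤ smoothErr u ∧ smoothErr u ≤ 75 / 1000 := by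
  rcases lt_or_ge u 100 with h | h
  · exact smoothErr_bounds_of_lt h5 h
  · exact smoothErr_bounds_of_ge h

theorem mangoldtHyp_eq {t : ℝ} (ht : 0 ≤ t) :
    mangoldtHyp t = logHyp t - logHyp (t / 2) - logHyp (t / 3) + coefFive * logHyp (t / 5)
      + coefEight * logHyp (t / 8) - ∑ n ∈ Ioc 0 ⌊t⌋₊, vonMangoldt n * smoothErr (t / n) := by
  rw [logHyp_eq_sum_hyp le_rfl ht, logHyp_eq_sum_hyp (by linarith : t / 2 ≤ t) (by linarith),
    logHyp_eq_sum_hyp (by linarith : t / 3 ≤ t) (by linarith),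
    logHyp_eq_sum_hyp (by linarith : t / 5 ≤ t) (by linarith),
    logHyp_eq_sum_hyp (by linarith : t / 8 ≤ t) (by linarith), mangoldtHyp,
    Finset.mul_sum, Finset.mul_sum, ← Finset.sum_sub_distrib, ← Finset.sum_sub_distrib,
    ← Finset.sum_add_distrib, ← Finset.sum_add_distrib, ← Finset.sum_sub_distrib]
  refine Finset.sum_congr rfl fun n _ => ?_
  rw [smoothErr, div_right_comm t 2, div_right_comm t 3, div_right_comm t 5, div_right_comm t 8]
  ring

theorem sum_smoothErr_bounds {t : ℝ} (ht : 0 ≤ t) :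
    -(20 / 1000) * Chebyshev.psi (t / 5)
        ≤ ∑ n ∈ Ioc 0 ⌊t⌋₊, vonMangoldt n * smoothErr (t / n) ∧
      ∑ n ∈ Ioc 0 ⌊t⌋₊, vonMangoldt n * smoothErr (t / n)
        ≤ 75 / 1000 * Chebyshev.psi (t / 5) := by
  have hsub : Ioc 0 ⌊t / 5⌋₊ ⊆ Ioc 0 ⌊t⌋₊ :=
    Ioc_subset_Ioc le_rfl (Nat.floor_mono (by linarith))
  rw [← Finset.sum_subset hsub]
  · have hb : ∀ n ∈ Ioc 0 ⌊t / 5⌋₊,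
        -(20 / 1000) ≤ smoothErr (t / n) ∧ smoothErr (t / n) ≤ 75 / 1000 := by
      intro n hn
      rw [mem_Ioc] at hn
      have hn0 : (0 : ℝ) < n := by exact_mod_cast hn.1
      have := (Nat.le_floor_iff (by linarith)).1 hn.2
      apply smoothErr_bounds
      rw [le_div_iff₀ hn0]
      linarith
    constructor
    · rw [Chebyshev.psi, Finset.mul_sum]
      refine Finset.sum_le_sum fun n hn => ?_
      rw [mul_comm]
      exact mul_le_mul_of_nonneg_left (hb n hn).1 vonMangoldt_nonneg
    · rw [Chebyshev.psi, Finset.mul_sum]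
      refine Finset.sum_le_sum fun n hn => ?_
      rw [mul_comm (75 / 1000 : ℝ)]
      exact mul_le_mul_of_nonneg_left (hb n hn).2 vonMangoldt_nonneg
  · intro n hn hn'
    simp only [mem_Ioc, not_and, not_le] at hn hn'
    have hn0 : (0 : ℝ) < n := by exact_mod_cast hn.1
    have h1 := (Nat.floor_lt (by linarith)).1 (hn' hn.1)
    have h2 := (Nat.le_floor_iff ht).1 hn.2
    rw [smoothErr_eq_zero, mul_zero]
    · rwa [le_div_iff₀ hn0, one_mul]
    · rw [div_lt_iff₀ hn0]
      linarith

theorem log_large_numerals :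
    (97980 / 10000 ≤ Real.log 18000 ∧ Real.log 18000 ≤ 97982 / 10000) ∧
    (114075 / 10000 ≤ Real.log 90000 ∧ Real.log 90000 ≤ 114077 / 10000) := by
  have h1 := Real.log_two_gt_d9
  have h2 := Real.log_two_lt_d9
  have h3 := Real.log_three_gt_d9
  have h4 := Real.log_three_lt_d9
  have h5 := Real.log_five_gt_d9
  have h6 := Real.log_five_lt_d9
  have e1 : Real.log 18000 = 4 * Real.log 2 + 2 * Real.log 3 + 3 * Real.log 5 := by
    rw [show (18000 : ℝ) = 2 ^ 4 * 3 ^ 2 * 5 ^ 3 by norm_num, Real.log_mul (by norm_num)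
      (by norm_num), Real.log_mul (by norm_num) (by norm_num), Real.log_pow, Real.log_pow,
      Real.log_pow]
    norm_num
  have e2 : Real.log 90000 = 4 * Real.log 2 + 2 * Real.log 3 + 4 * Real.log 5 := by
    rw [show (90000 : ℝ) = 2 ^ 4 * 3 ^ 2 * 5 ^ 4 by norm_num, Real.log_mul (by norm_num)
      (by norm_num), Real.log_mul (by norm_num) (by norm_num), Real.log_pow, Real.log_pow,
      Real.log_pow]
    norm_num
  rw [e1, e2]
  refine ⟨⟨?_, ?_⟩, ?_, ?_⟩ <;> linarith

theorem log_four : Real.log 4 = 2 * Real.log 2 := by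
  rw [show (4 : ℝ) = 2 ^ 2 by norm_num, Real.log_pow]
  norm_num

theorem exp_two_le : Real.exp 2 ≤ 9 := by
  have h := Real.exp_one_lt_d9
  have h0 := Real.exp_pos 1
  have : Real.exp 2 = Real.exp 1 * Real.exp 1 := by
    rw [← Real.exp_add]
    norm_num
  nlinarith

theorem psi_le_of_ge {y : ℝ} (hy : 18000 ≤ y) : Chebyshev.psi y ≤ 15326 / 10000 * y := by
  have h1 := Chebyshev.psi_sub_theta_le (x := y) (by linarith)
  have h2 := Chebyshev.theta_le_log4_mul_x (x := y) (by linarith)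
  have h3 := Real.log_div_sqrt_antitoneOn (a := 18000) (b := y)
    (by simp only [Set.mem_Ici]; linarith [exp_two_le])
    (by simp only [Set.mem_Ici]; linarith [exp_two_le]) hy
  have h4 : (1341 / 10 : ℝ) ≤ √18000 := Real.le_sqrt_of_sq_le (by norm_num)
  have h5 := log_large_numerals.1.2
  have h6 : Real.log 18000 / √18000 ≤ (97982 / 10000) / (1341 / 10) :=
    div_le_div₀ (by norm_num) h5 (by norm_num) h4
  have hs : 0 < √y := Real.sqrt_pos.2 (by linarith)
  have h7 : Real.log y ≤ (97982 / 10000) / (1341 / 10) * √y := by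
    rw [← div_le_iff₀ hs]
    exact h3.trans h6
  have h8 : √y * √y = y := Real.mul_self_sqrt (by linarith)
  have h9 : √y * Real.log y ≤ (97982 / 10000) / (1341 / 10) * y := by
    calc √y * Real.log y ≤ √y * ((97982 / 10000) / (1341 / 10) * √y) :=
          mul_le_mul_of_nonneg_left h7 hs.le
      _ = (97982 / 10000) / (1341 / 10) * (√y * √y) := by ring
      _ = _ := by rw [h8]
  rw [log_four] at h2
  have := Real.log_two_lt_d9
  nlinarith

theorem exists_mangoldtHyp_const :
    ∃ D : ℝ, ∀ t : ℝ, 90000 ≤ t →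
      D ≤ mangoldtHyp t / t - Real.log t ∧ mangoldtHyp t / t - Real.log t ≤ D + 33 / 1000 := by
  obtain ⟨C, hC⟩ := exists_logHyp_const
  refine ⟨(-(Real.log 2 ^ 2 / 2) - Real.log 3 ^ 2 / 3 + coefFive * (Real.log 5 ^ 2 / 5)
    + coefEight * ((3 * Real.log 2) ^ 2 / 8)) / 2 - 1 - 251 / 10000, fun t ht => ?_⟩
  have ht0 : 0 < t := by linarith
  obtain ⟨s1, s2⟩ := sum_smoothErr_bounds ht0.le
  have hpsi := psi_le_of_ge (show 18000 ≤ t / 5 by linarith)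
  have hpsi0 := Chebyshev.psi_nonneg (t / 5)
  have hlog0 : 0 ≤ Real.log t := Real.log_nonneg (by linarith)
  have hlog : Real.log t ≤ 114077 / 10000 / 90000 * t := by
    have := Real.log_div_self_antitoneOn (a := 90000) (b := t)
      (by simp only [Set.mem_Ici]; linarith [Real.exp_one_lt_d9])
      (by simp only [Set.mem_Ici]; linarith [Real.exp_one_lt_d9]) ht
    have h5 := log_large_numerals.2.2
    rw [← div_le_iff₀ ht0]
    simp only at this
    linarith
  have hW : ∀ k : ℕ, 1 ≤ k → k ≤ 8 →
      |logHyp (t / k) - t / k * ((Real.log t - Real.log k) ^ 2 / 2 - (Real.log t - Real.log k) + C)|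
        ≤ 1 + 3 * Real.log t := by
    intro k hk hk8
    have hk0 : (1 : ℝ) ≤ k := by exact_mod_cast hk
    have hk8' : (k : ℝ) ≤ 8 := by exact_mod_cast hk8
    have : 4 ≤ t / k := by
      rw [le_div_iff₀ (by linarith)]
      linarith
    have h := hC (t / k) this
    rw [Real.log_div (by linarith) (by linarith)] at h
    have := Real.log_nonneg hk0
    linarith
  have w1 := hW 1 (by norm_num) (by norm_num)
  have w2 := hW 2 (by norm_num) (by norm_num)
  have w3 := hW 3 (by norm_num) (by norm_num)
  have w5 := hW 5 (by norm_num) (by norm_num)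
  have w8 := hW 8 (by norm_num) (by norm_num)
  push_cast [log_eight] at w1 w2 w3 w5 w8
  rw [Real.log_one, div_one] at w1
  have hc := coef_log_sum
  have hc8 : coefEight = -(4 / 3) - 8 * coefFive / 5 := rfl
  obtain ⟨c1, c2⟩ := coefFive_bounds
  have key : mangoldtHyp t - t * Real.log t - t * ((-(Real.log 2 ^ 2 / 2) - Real.log 3 ^ 2 / 3
      + coefFive * (Real.log 5 ^ 2 / 5) + coefEight * ((3 * Real.log 2) ^ 2 / 8)) / 2 - 1) =
      (logHyp t - t * ((Real.log t - 0) ^ 2 / 2 - (Real.log t - 0) + C))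
      - (logHyp (t / 2) - t / 2 * ((Real.log t - Real.log 2) ^ 2 / 2
          - (Real.log t - Real.log 2) + C))
      - (logHyp (t / 3) - t / 3 * ((Real.log t - Real.log 3) ^ 2 / 2
          - (Real.log t - Real.log 3) + C))
      + coefFive * (logHyp (t / 5) - t / 5 * ((Real.log t - Real.log 5) ^ 2 / 2
          - (Real.log t - Real.log 5) + C))
      + coefEight * (logHyp (t / 8) - t / 8 * ((Real.log t - 3 * Real.log 2) ^ 2 / 2
          - (Real.log t - 3 * Real.log 2) + C))
      - ∑ n ∈ Ioc 0 ⌊t⌋₊, vonMangoldt n * smoothErr (t / n) := by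
    rw [mangoldtHyp_eq ht0.le]
    linear_combination (t - t * Real.log t) * hc
      + (t / 8 * (Real.log t ^ 2 / 2 - Real.log t + C)) * hc8
  generalize logHyp t - t * ((Real.log t - 0) ^ 2 / 2 - (Real.log t - 0) + C) = e1 at *
  generalize logHyp (t / 2) - t / 2 * ((Real.log t - Real.log 2) ^ 2 / 2
          - (Real.log t - Real.log 2) + C) = e2 at *
  generalize logHyp (t / 3) - t / 3 * ((Real.log t - Real.log 3) ^ 2 / 2
          - (Real.log t - Real.log 3) + C) = e3 at *
  generalize logHyp (t / 5) - t / 5 * ((Real.log t - Real.log 5) ^ 2 / 2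
          - (Real.log t - Real.log 5) + C) = e5 at *
  generalize logHyp (t / 8) - t / 8 * ((Real.log t - 3 * Real.log 2) ^ 2 / 2
          - (Real.log t - 3 * Real.log 2) + C) = e8 at *
  have q5 : |coefFive * e5| ≤ 6315 / 10000 * (1 + 3 * Real.log t) := by
    rw [abs_mul]
    exact mul_le_mul (abs_le.2 ⟨by linarith, by linarith⟩) w5 (abs_nonneg _) (by norm_num)
  have q8 : |coefEight * e8| ≤ 3234 / 10000 * (1 + 3 * Real.log t) := by
    rw [abs_mul]
    exact mul_le_mul (abs_le.2 ⟨by linarith, by linarith⟩) w8 (abs_nonneg _) (by norm_num)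
  rw [abs_le] at w1 w2 w3 q5 q8
  generalize (-(Real.log 2 ^ 2 / 2) - Real.log 3 ^ 2 / 3
      + coefFive * (Real.log 5 ^ 2 / 5) + coefEight * ((3 * Real.log 2) ^ 2 / 8)) / 2 = E at *
  constructor
  · rw [le_sub_iff_add_le, le_div_iff₀ ht0]
    nlinarith
  · rw [sub_le_iff_le_add, div_le_iff₀ ht0]
    nlinarith

/-- The weight `1 / log t + 1 / log² t`. -/
noncomputable def kap (t : ℝ) : ℝ := 1 / Real.log t + 1 / Real.log t ^ 2

theorem monotone_smoothing {S₁ S₂ P lo a b : ℝ} (ha : 1 < a) (hab : a ≤ b)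
    (hG : ∀ t, a ≤ t → t ≤ b → lo ≤ S₁ - P / t - Real.log t) :
    S₂ - P / (a * Real.log a) - Real.log (Real.log a) + 1 / Real.log a
        - (S₁ - P / a - Real.log a - lo) * kap a
      ≤ S₂ - P / (b * Real.log b) - Real.log (Real.log b) + 1 / Real.log b
        - (S₁ - P / b - Real.log b - lo) * kap b := by
  let φ : ℝ → ℝ := fun t => S₂ - P / (t * Real.log t) - Real.log (Real.log t) + 1 / Real.log t
        - (S₁ - P / t - Real.log t - lo) * kap t
  have hd : ∀ t, a ≤ t → HasDerivAt φ ((S₁ - P / t - Real.log t - lo) *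
      (1 / (t * Real.log t ^ 2) + 2 / (t * Real.log t ^ 3))) t := by
    intro t ht
    have ht0 : t ≠ 0 := by linarith
    have hl : 0 < Real.log t := Real.log_pos (by linarith)
    have hlog := Real.hasDerivAt_log ht0
    have h1 : HasDerivAt (fun t => 1 / Real.log t) (-(t⁻¹) / Real.log t ^ 2) t := by
      simpa only [one_div] using hlog.fun_inv hl.ne'
    have h2 : HasDerivAt (fun t => 1 / Real.log t ^ 2) (-(2 * Real.log t * t⁻¹)
        / (Real.log t ^ 2) ^ 2) t := by
      have := (hlog.fun_pow 2).fun_inv (pow_pos hl 2).ne'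
      simpa using this
    have h3 := (((hasDerivAt_id t).fun_mul hlog).fun_inv (mul_pos (by linarith : 0 < t) hl).ne').const_mul P
    have h4 := (hasDerivAt_inv ht0).const_mul P
    have h5 := hlog.log hl.ne'
    have h6 := ((((hasDerivAt_const t S₂).fun_sub h3).fun_sub h5).fun_add h1).fun_sub
      (((((hasDerivAt_const t S₁).fun_sub h4).fun_sub hlog).fun_sub (hasDerivAt_const t lo)).fun_mul
        (h1.fun_add h2))
    refine (h6.congr_deriv ?_).congr_of_eventuallyEq (Eventually.of_forall fun s => ?_)
    · simp only [id]
      field_simp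
      ring
    · simp only [φ, kap, div_eq_mul_inv, id]
  have hmono : MonotoneOn φ (Set.Icc a b) := by
    refine monotoneOn_of_deriv_nonneg (convex_Icc a b) ?_ ?_ ?_
    · exact fun t ht => (hd t ht.1).continuousAt.continuousWithinAt
    · exact fun t ht => (hd t (interior_subset ht).1).differentiableAt.differentiableWithinAt
    · intro t ht
      have ht' := interior_subset ht
      rw [(hd t ht'.1).deriv]
      have hl : 0 < Real.log t := Real.log_pos (by linarith [ht'.1])
      have ht0 : 0 < t := by linarith [ht'.1]
      have := hG t ht'.1 ht'.2
      exact mul_nonneg (by linarith) (by positivity)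
  exact hmono (Set.left_mem_Icc.2 hab) (Set.right_mem_Icc.2 hab) hab

/-- `∑_{n ≤ t} Λ(n) / (n log n)`. -/
noncomputable def primeSum (t : ℝ) : ℝ := ∑ n ∈ Ioc 0 ⌊t⌋₊, vonMangoldt n / (n * Real.log n)

/-- The smoothed and compensated version of `primeSum t - log log t`. -/
noncomputable def smoothedSum (lo t : ℝ) : ℝ :=
  primeSum t - Chebyshev.psi t / (t * Real.log t) - Real.log (Real.log t) + 1 / Real.log t
    - (mangoldtHyp t / t - Real.log t - lo) * kap t

theorem mangoldtHyp_eq_sub (t : ℝ) :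
    mangoldtHyp t = t * ∑ n ∈ Ioc 0 ⌊t⌋₊, vonMangoldt n / n - Chebyshev.psi t := by
  rw [mangoldtHyp, Chebyshev.psi, Finset.mul_sum, ← Finset.sum_sub_distrib]
  refine Finset.sum_congr rfl fun n _ => ?_
  ring

theorem sums_eq_of_mem_Icc {m : ℕ} {t : ℝ} (h1 : m ≤ t) (h2 : t ≤ m + 1) (hm : 1 ≤ m) :
    mangoldtHyp t / t = ∑ n ∈ Ioc 0 m, vonMangoldt n / n - (∑ n ∈ Ioc 0 m, vonMangoldt n) / t ∧
    primeSum t - Chebyshev.psi t / (t * Real.log t)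
      = ∑ n ∈ Ioc 0 m, vonMangoldt n / (n * Real.log n)
        - (∑ n ∈ Ioc 0 m, vonMangoldt n) / (t * Real.log t) := by
  have hm1 : (1 : ℝ) ≤ m := by exact_mod_cast hm
  have ht0 : t ≠ 0 := by linarith
  rw [mangoldtHyp_eq_sub, primeSum, Chebyshev.psi]
  rcases h2.lt_or_eq with h | h
  · have : ⌊t⌋₊ = m := (Nat.floor_eq_iff (by linarith)).2 ⟨h1, h⟩
    rw [this]
    refine ⟨?_, rfl⟩
    field_simp
  · have : ⌊t⌋₊ = m + 1 := by
      rw [h]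
      exact_mod_cast Nat.floor_natCast (R := ℝ) (m + 1)
    rw [this, Finset.sum_Ioc_succ_top (Nat.zero_le m), Finset.sum_Ioc_succ_top (Nat.zero_le m),
      Finset.sum_Ioc_succ_top (Nat.zero_le m)]
    have e : ((m + 1 : ℕ) : ℝ) = t := by rw [h]; push_cast; rfl
    rw [e]
    constructor
    · field_simp
      ring
    · ring

theorem smoothedSum_mono {lo X : ℝ} (hX : 1 < X)
    (hG : ∀ t, X ≤ t → lo ≤ mangoldtHyp t / t - Real.log t) {x z : ℝ} (hx : X ≤ x) (hxz : x ≤ z) :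
    smoothedSum lo x ≤ smoothedSum lo z := by
  have step : ∀ (m : ℕ) (a b : ℝ), X ≤ a → a ≤ b → m ≤ a → b ≤ m + 1 → 1 ≤ m →
      smoothedSum lo a ≤ smoothedSum lo b := by
    intro m a b hXa hab hma hbm hm
    obtain ⟨a1, a2⟩ := sums_eq_of_mem_Icc hma (by linarith) hm
    obtain ⟨b1, b2⟩ := sums_eq_of_mem_Icc (by linarith) hbm hm
    rw [smoothedSum, smoothedSum, a1, a2, b1, b2]
    refine monotone_smoothing (by linarith) hab fun t hat htb => ?_
    have := hG t (by linarith)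
    rwa [(sums_eq_of_mem_Icc (by linarith) (by linarith) hm).1] at this
  have hfx : 1 ≤ ⌊x⌋₊ := (Nat.one_le_floor_iff x).2 (by linarith)
  have hx0 := Nat.floor_le (show 0 ≤ x by linarith)
  have key : ∀ k : ℕ, ∀ z : ℝ, x ≤ z → z ≤ ⌊x⌋₊ + k + 1 →
      smoothedSum lo x ≤ smoothedSum lo z := by
    intro k
    induction k with
    | zero =>
      intro z h1 h2
      push_cast at h2
      exact step ⌊x⌋₊ x z hx h1 hx0 (by linarith) hfx
    | succ k ih =>
      intro z h1 h2
      push_cast at h2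
      have hfl := Nat.lt_floor_add_one x
      rcases le_or_gt z (⌊x⌋₊ + k + 1) with h | h
      · exact ih z h1 h
      · refine (ih (⌊x⌋₊ + k + 1) ?_ le_rfl).trans
          (step (⌊x⌋₊ + k + 1) _ z ?_ h.le ?_ ?_ (by omega))
        · have : (0 : ℝ) ≤ k := by positivity
          linarith
        · have : (0 : ℝ) ≤ k := by positivity
          linarith
        · push_cast
          exact le_rfl
        · push_cast
          linarith
  obtain ⟨k, hk⟩ := exists_nat_ge z
  refine key k z hxz ?_
  have : (0 : ℝ) ≤ ⌊x⌋₊ := by positivity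
  linarith

theorem primeSum_le_of_le {x z : ℝ} (hx : 90000 ≤ x) (hxz : x ≤ z) :
    primeSum x - Chebyshev.psi x / (x * Real.log x) - Real.log (Real.log x) + 1 / Real.log x
      ≤ 33 / 1000 * kap x + (primeSum z - Real.log (Real.log z) + 1 / Real.log z) := by
  obtain ⟨D, hD⟩ := exists_mangoldtHyp_const
  have h := smoothedSum_mono (by norm_num) (fun t ht => (hD t ht).1) hx hxz
  rw [smoothedSum, smoothedSum] at h
  have kx : 0 ≤ kap x := by
    have := Real.log_pos (show 1 < x by linarith)
    rw [kap]
    positivity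
  have hlz := Real.log_pos (show 1 < z by linarith)
  have kz : 0 ≤ kap z := by
    rw [kap]
    positivity
  have h1 := mul_le_mul_of_nonneg_right (show mangoldtHyp x / x - Real.log x - D ≤ 33 / 1000 by
    linarith [(hD x hx).2]) kx
  have h2 := mul_nonneg (show 0 ≤ mangoldtHyp z / z - Real.log z - D by
    linarith [(hD z (by linarith)).1]) kz
  have h3 : 0 ≤ Chebyshev.psi z / (z * Real.log z) :=
    div_nonneg (Chebyshev.psi_nonneg z) (mul_nonneg (by linarith) hlz.le)
  linarith

theorem sum_Ioc_eq_sum_primesLE {g : ℕ → ℝ} (hg : ∀ n, ¬ IsPrimePow n → g n = 0) (N : ℕ) :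
    ∑ n ∈ Ioc 0 N, g n = ∑ p ∈ N.primesLE, ∑ k ∈ Icc 1 (Nat.log p N), g (p ^ k) := by
  have hinj : Set.InjOn (fun x : (_ : ℕ) × ℕ => x.1 ^ x.2)
      (N.primesLE.sigma fun p => Icc 1 (Nat.log p N)) := by
    rintro ⟨p, k⟩ hx ⟨q, l⟩ hy h
    simp only [coe_sigma, Set.mem_sigma_iff, mem_coe, Nat.mem_primesLE, mem_Icc] at hx hy h
    obtain ⟨rfl, rfl⟩ := Nat.Prime.pow_inj' hx.1.2 hy.1.2 (by omega) (by omega) h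
    rfl
  rw [Finset.sum_sigma', ← Finset.sum_image (f := g) hinj]
  refine (Finset.sum_subset ?_ ?_).symm
  · intro q hq
    simp only [mem_image, mem_sigma, Nat.mem_primesLE, mem_Icc] at hq
    obtain ⟨⟨p, k⟩, ⟨⟨h1, h2⟩, h3, h4⟩, rfl⟩ := hq
    have hN : N ≠ 0 := by
      have := h2.pos
      omega
    exact mem_Ioc.2 ⟨pow_pos h2.pos _, Nat.pow_le_of_le_log hN h4⟩
  · intro n hn hn'
    refine hg n fun hpp => hn' ?_
    obtain ⟨p, k, hp, hk, rfl⟩ := (isPrimePow_nat_iff n).1 hpp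
    rw [mem_Ioc] at hn
    simp only [mem_image, mem_sigma, Nat.mem_primesLE, mem_Icc]
    refine ⟨⟨p, k⟩, ⟨⟨?_, hp⟩, hk, Nat.le_log_of_pow_le hp.one_lt hn.2⟩, rfl⟩
    exact (Nat.le_of_dvd hn.1 (dvd_pow_self p hk.ne')).trans hn.2

theorem sum_vonMangoldt_div_log (f : ℕ → ℝ) (N : ℕ) :
    ∑ n ∈ Ioc 0 N, vonMangoldt n / Real.log n * f n
      = ∑ p ∈ N.primesLE, ∑ k ∈ Icc 1 (Nat.log p N), f (p ^ k) / k := by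
  rw [sum_Ioc_eq_sum_primesLE]
  · refine Finset.sum_congr rfl fun p hp => Finset.sum_congr rfl fun k hk => ?_
    have hp' := Nat.prime_of_mem_primesLE hp
    have hk0 : k ≠ 0 := by
      have := (mem_Icc.1 hk).1
      omega
    have hl : 0 < Real.log p := Real.log_pos (by exact_mod_cast hp'.one_lt)
    have hk1 : (k : ℝ) ≠ 0 := by exact_mod_cast hk0
    rw [ArithmeticFunction.vonMangoldt_apply_pow hk0,
      ArithmeticFunction.vonMangoldt_apply_prime hp']
    push_cast
    rw [Real.log_pow]
    field_simp
  · intro n hn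
    rw [ArithmeticFunction.vonMangoldt_eq_zero_iff.2 hn]
    simp

/-- `n ↦ n ^ (-s)` as a monoid homomorphism. -/
noncomputable def rpowNegHom (s : ℝ) : ℕ →* ℝ where
  toFun n := (n : ℝ) ^ (-s)
  map_one' := by simp
  map_mul' m n := by
    push_cast
    exact Real.mul_rpow (by positivity) (by positivity)

theorem rpow_step {δ : ℝ} (hδ : 0 < δ) {n : ℕ} (hn : 1 ≤ n) :
    ((n + 1 : ℕ) : ℝ) ^ (-(1 + δ)) ≤ ((n : ℝ) ^ (-δ) - ((n + 1 : ℕ) : ℝ) ^ (-δ)) / δ := by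
  have hn0 : (0 : ℝ) < n := by exact_mod_cast hn
  have hm0 : (0 : ℝ) < (n + 1 : ℕ) := by positivity
  have h1 : 1 + δ * (1 / ((n + 1 : ℕ) : ℝ)) ≤ ((n : ℝ) / (n + 1 : ℕ)) ^ (-δ) := by
    rw [Real.rpow_def_of_pos (by positivity)]
    refine le_trans ?_ (Real.add_one_le_exp _)
    have h2 := inv_succ_le_log_succ_sub hn0
    rw [Real.log_div hn0.ne' hm0.ne']
    push_cast
    nlinarith
  rw [Real.div_rpow hn0.le hm0.le, le_div_iff₀ (by positivity)] at h1
  rw [le_div_iff₀ hδ, show -(1 + δ) = -δ + -1 by ring, Real.rpow_add hm0, Real.rpow_neg_one]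
  rw [one_div] at h1
  linarith

theorem sum_rpow_le {δ : ℝ} (hδ : 0 < δ) (N : ℕ) :
    ∑ n ∈ range N, (n : ℝ) ^ (-(1 + δ)) ≤ 1 + 1 / δ := by
  have key : ∀ m : ℕ, ∑ n ∈ range (m + 2), (n : ℝ) ^ (-(1 + δ))
      ≤ 1 + (1 - ((m + 1 : ℕ) : ℝ) ^ (-δ)) / δ := by
    intro m
    induction m with
    | zero =>
      have : (-(1 + δ)) ≠ 0 := by linarith
      rw [Finset.sum_range_succ, Finset.sum_range_succ, Finset.sum_range_zero, Nat.cast_zero,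
        Real.zero_rpow this]
      simp
    | succ m ih =>
      rw [Finset.sum_range_succ]
      have := rpow_step hδ (n := m + 1) (by omega)
      refine (add_le_add ih this).trans (le_of_eq ?_)
      ring
  have h1 : ∑ n ∈ range N, (n : ℝ) ^ (-(1 + δ)) ≤ ∑ n ∈ range (N + 2), (n : ℝ) ^ (-(1 + δ)) :=
    Finset.sum_le_sum_of_subset_of_nonneg (range_mono (by omega))
      fun n _ _ => Real.rpow_nonneg (by positivity) _
  refine h1.trans ((key N).trans ?_)
  have h2 : (0 : ℝ) ≤ ((N + 1 : ℕ) : ℝ) ^ (-δ) := Real.rpow_nonneg (by positivity) _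
  gcongr
  linarith

theorem sum_Icc_pow_div_le {x : ℝ} (h0 : 0 ≤ x) (h1 : x < 1) (K : ℕ) :
    ∑ k ∈ Icc 1 K, x ^ k / k ≤ -Real.log (1 - x) := by
  have h := Real.hasSum_pow_div_log_of_abs_lt_one (abs_lt.2 ⟨by linarith, h1⟩)
  have := sum_le_hasSum (range K) (fun i _ => by positivity) h
  refine le_trans (le_of_eq ?_) this
  clear this
  induction K with
  | zero => simp
  | succ K ih =>
    rw [Finset.sum_Icc_succ_top (by omega), ih, Finset.sum_range_succ]
    push_cast
    rfl

theorem sum_vonMangoldt_rpow_le {δ : ℝ} (hδ : 0 < δ) (N : ℕ) :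
    ∑ n ∈ Ioc 0 N, vonMangoldt n / Real.log n * (n : ℝ) ^ (-(1 + δ)) ≤ Real.log (1 + 1 / δ) := by
  have hlt : ∀ {p : ℕ}, p.Prime → (p : ℝ) ^ (-(1 + δ)) < 1 := fun hp =>
    Real.rpow_lt_one_of_one_lt_of_neg (by exact_mod_cast hp.one_lt) (by linarith)
  have hnn : ∀ n : ℕ, 0 ≤ (n : ℝ) ^ (-(1 + δ)) := fun n => Real.rpow_nonneg (by positivity) _
  have hsum : Summable (rpowNegHom (1 + δ)) :=
    summable_of_sum_range_le (c := 1 + 1 / δ) hnn (sum_rpow_le hδ)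
  rw [sum_vonMangoldt_div_log]
  calc ∑ p ∈ N.primesLE, ∑ k ∈ Icc 1 (Nat.log p N), ((p ^ k : ℕ) : ℝ) ^ (-(1 + δ)) / k
      ≤ ∑ p ∈ N.primesLE, Real.log (1 - (p : ℝ) ^ (-(1 + δ)))⁻¹ := by
        refine Finset.sum_le_sum fun p hp => ?_
        have hp' := Nat.prime_of_mem_primesLE hp
        rw [Real.log_inv]
        refine le_trans (le_of_eq ?_) (sum_Icc_pow_div_le (hnn p) (hlt hp') (Nat.log p N))
        refine Finset.sum_congr rfl fun k _ => ?_
        rw [Nat.cast_pow, Real.rpow_pow_comm (by positivity)]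
    _ = Real.log (∏ p ∈ N.primesLE, (1 - (p : ℝ) ^ (-(1 + δ)))⁻¹) := by
        rw [Real.log_prod]
        intro p hp
        have := hlt (Nat.prime_of_mem_primesLE hp)
        exact inv_ne_zero (by linarith)
    _ ≤ Real.log (1 + 1 / δ) := by
        refine Real.log_le_log ?_ ?_
        · refine Finset.prod_pos fun p hp => ?_
          have := hlt (Nat.prime_of_mem_primesLE hp)
          exact inv_pos.2 (by linarith)
        · have h := EulerProduct.prod_primesBelow_geometric_eq_tsum_smoothNumbers hsum (N + 1)
          refine (le_of_eq h).trans ?_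
          refine (Summable.tsum_subtype_le _ _ hnn hsum).trans ?_
          exact Real.tsum_le_of_sum_range_le hnn (sum_rpow_le hδ)

/-- `primeSum` at integer powers of `e`. -/
noncomputable def primeSumExp (k : ℕ) : ℝ := primeSum (Real.exp k)

theorem floor_exp_mono (k : ℕ) : ⌊Real.exp k⌋₊ ≤ ⌊Real.exp (k + 1 : ℕ)⌋₊ :=
  Nat.floor_mono (Real.exp_le_exp.2 (by push_cast; linarith))

theorem weighted_step {δ : ℝ} (hδ : 0 < δ) (k : ℕ) :
    ∑ n ∈ Ioc 0 ⌊Real.exp k⌋₊, vonMangoldt n / Real.log n * (n : ℝ) ^ (-(1 + δ))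
      + Real.exp (-(δ * (k + 1 : ℕ))) * (primeSumExp (k + 1) - primeSumExp k)
    ≤ ∑ n ∈ Ioc 0 ⌊Real.exp (k + 1 : ℕ)⌋₊, vonMangoldt n / Real.log n * (n : ℝ) ^ (-(1 + δ)) := by
  have hsub : Ioc 0 ⌊Real.exp k⌋₊ ⊆ Ioc 0 ⌊Real.exp (k + 1 : ℕ)⌋₊ :=
    Ioc_subset_Ioc le_rfl (floor_exp_mono k)
  rw [primeSumExp, primeSumExp, primeSum, primeSum, ← Finset.sum_sdiff hsub,
    ← Finset.sum_sdiff (f := fun n : ℕ => vonMangoldt n / Real.log n * (n : ℝ) ^ (-(1 + δ))) hsub,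
    add_sub_cancel_right, add_comm, Finset.mul_sum]
  refine add_le_add ?_ le_rfl
  refine Finset.sum_le_sum fun n hn => ?_
  obtain ⟨hn1, hn2⟩ := mem_Ioc.1 (mem_sdiff.1 hn).1
  have hn0 : (0 : ℝ) < n := by exact_mod_cast hn1
  have h1 : (n : ℝ) ≤ Real.exp (k + 1 : ℕ) := (Nat.le_floor_iff (Real.exp_pos _).le).1 hn2
  have h2 : Real.log n ≤ (k + 1 : ℕ) := by
    rw [← Real.log_exp ((k + 1 : ℕ) : ℝ)]
    exact Real.log_le_log hn0 h1
  have h3 : Real.exp (-(δ * (k + 1 : ℕ))) * (n : ℝ)⁻¹ ≤ (n : ℝ) ^ (-(1 + δ)) := by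
    rw [show -(1 + δ) = -δ + -1 by ring, Real.rpow_add hn0, Real.rpow_neg_one,
      Real.rpow_def_of_pos hn0]
    refine mul_le_mul_of_nonneg_right (Real.exp_le_exp.2 ?_) (by positivity)
    nlinarith
  have h4 : 0 ≤ vonMangoldt n / Real.log n :=
    div_nonneg vonMangoldt_nonneg (Real.log_nonneg (by exact_mod_cast hn1))
  refine le_trans (le_of_eq ?_) (mul_le_mul_of_nonneg_left h3 h4)
  rw [div_eq_mul_inv, div_eq_mul_inv, mul_inv]
  ring

theorem primeSumExp_nonneg (k : ℕ) : 0 ≤ primeSumExp k := by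
  rw [primeSumExp, primeSum]
  refine Finset.sum_nonneg fun n hn => div_nonneg vonMangoldt_nonneg ?_
  have h1 : (1 : ℝ) ≤ n := by exact_mod_cast (mem_Ioc.1 hn).1
  exact mul_nonneg (by linarith) (Real.log_nonneg h1)

/-- Partial sums of `-log (1 - e^(-δ))`. -/
noncomputable def expHarm (δ : ℝ) (K : ℕ) : ℝ := ∑ k ∈ range K, Real.exp (-δ) ^ (k + 1) / (k + 1)

theorem weighted_lower {δ : ℝ} (hδ : 0 < δ) (c : ℝ) (k₀ : ℕ)
    (hc : ∀ k, k₀ ≤ k → harm k + c ≤ primeSumExp k) (k : ℕ) :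
    expHarm δ (k₀ + k) + c * Real.exp (-(δ * k₀)) - harm k₀ * (1 - Real.exp (-(δ * k₀)))
      ≤ ∑ n ∈ Ioc 0 ⌊Real.exp (k₀ + k : ℕ)⌋₊,
          vonMangoldt n / Real.log n * (n : ℝ) ^ (-(1 + δ)) := by
  have hexp : ∀ k : ℕ, Real.exp (-δ) ^ (k + 1) = Real.exp (-(δ * (k + 1 : ℕ))) := by
    intro k
    rw [← Real.exp_nat_mul]
    congr 1
    ring
  have hexp_le : ∀ k : ℕ, Real.exp (-(δ * (k + 1 : ℕ))) ≤ Real.exp (-(δ * k)) := by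
    intro k
    refine Real.exp_le_exp.2 ?_
    push_cast
    nlinarith
  have harm_mono : Monotone harm := monotone_nat_of_le_succ fun n => by
    rw [harm_succ]
    have : 0 ≤ 1 / ((n : ℝ) + 1) := by positivity
    linarith
  have lower : ∀ k, k ≤ k₀ → expHarm δ k + Real.exp (-(δ * k)) * (primeSumExp k - harm k + harm k₀)
      - harm k₀ ≤ ∑ n ∈ Ioc 0 ⌊Real.exp k⌋₊,
          vonMangoldt n / Real.log n * (n : ℝ) ^ (-(1 + δ)) := by
    intro k
    induction k with
    | zero =>
      intro _
      simp [expHarm, primeSumExp, primeSum, harm]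
    | succ k ih =>
      intro hk
      refine le_trans ?_ (weighted_step hδ k)
      have h1 := ih (by omega)
      have h2 : expHarm δ (k + 1) = expHarm δ k + Real.exp (-(δ * (k + 1 : ℕ))) * (1 / (k + 1)) := by
        rw [expHarm, Finset.sum_range_succ, hexp, expHarm]
        ring
      have h3 := mul_le_mul_of_nonneg_right (hexp_le k)
        (show 0 ≤ primeSumExp k - harm k + harm k₀ by
          linarith [harm_mono (show k ≤ k₀ by omega), primeSumExp_nonneg k])
      rw [h2, harm_succ]
      linarith
  have upper : ∀ k, expHarm δ (k₀ + k) + Real.exp (-(δ * (k₀ + k : ℕ)))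
      * (primeSumExp (k₀ + k) - harm (k₀ + k) - c)
      + c * Real.exp (-(δ * k₀)) - harm k₀ * (1 - Real.exp (-(δ * k₀)))
      ≤ ∑ n ∈ Ioc 0 ⌊Real.exp (k₀ + k : ℕ)⌋₊,
          vonMangoldt n / Real.log n * (n : ℝ) ^ (-(1 + δ)) := by
    intro k
    induction k with
    | zero =>
      refine le_trans (le_of_eq ?_) (lower k₀ le_rfl)
      rw [add_zero]
      ring
    | succ k ih =>
      refine le_trans ?_ (weighted_step hδ (k₀ + k))
      have h2 : expHarm δ (k₀ + (k + 1)) = expHarm δ (k₀ + k)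
          + Real.exp (-(δ * (k₀ + k + 1 : ℕ))) * (1 / ((k₀ + k : ℕ) + 1)) := by
        rw [expHarm, ← add_assoc, Finset.sum_range_succ, hexp, expHarm]
        ring
      have h3 := mul_le_mul_of_nonneg_right (hexp_le (k₀ + k))
        (show 0 ≤ primeSumExp (k₀ + k) - harm (k₀ + k) - c by linarith [hc (k₀ + k) (by omega)])
      rw [h2, ← add_assoc, harm_succ]
      linarith
  refine le_trans ?_ (upper k)
  have := mul_nonneg (Real.exp_pos (-(δ * (k₀ + k : ℕ)))).le
    (show 0 ≤ primeSumExp (k₀ + k) - harm (k₀ + k) - c by linarith [hc (k₀ + k) (by omega)])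
  linarith

theorem not_harm_add_le_primeSumExp {c : ℝ} (hc0 : 0 < c) (k₀ : ℕ) :
    ¬ ∀ k, k₀ ≤ k → harm k + c ≤ primeSumExp k := by
  intro hc
  have hh : 0 ≤ harm k₀ := Finset.sum_nonneg fun _ _ => by positivity
  have main : ∀ δ : ℝ, 0 < δ → c * Real.exp (-(δ * k₀)) - harm k₀ * (1 - Real.exp (-(δ * k₀))) ≤ δ := by
    intro δ hδ
    have hx : Real.exp (-δ) < 1 := Real.exp_lt_one_iff.2 (by linarith)
    have hlim := (Real.hasSum_pow_div_log_of_abs_lt_one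
      (abs_lt.2 ⟨by linarith [Real.exp_pos (-δ)], hx⟩)).tendsto_sum_nat
    have hle : -Real.log (1 - Real.exp (-δ)) ≤ Real.log (1 + 1 / δ) - (c * Real.exp (-(δ * k₀))
        - harm k₀ * (1 - Real.exp (-(δ * k₀)))) := by
      refine le_of_tendsto hlim ?_
      filter_upwards [eventually_ge_atTop k₀] with k hk
      obtain ⟨j, rfl⟩ := Nat.exists_eq_add_of_le hk
      have h1 := weighted_lower hδ c k₀ hc j
      have h2 := sum_vonMangoldt_rpow_le hδ ⌊Real.exp (k₀ + j : ℕ)⌋₊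
      rw [expHarm] at h1
      linarith
    have h3 : Real.log (1 - Real.exp (-δ)) ≤ Real.log δ := by
      refine Real.log_le_log (by linarith) ?_
      linarith [Real.add_one_le_exp (-δ)]
    have h4 : Real.log (1 + 1 / δ) = Real.log (1 + δ) - Real.log δ := by
      rw [← Real.log_div (by linarith) hδ.ne']
      congr 1
      field_simp
      ring
    have h5 : Real.log (1 + δ) ≤ δ := by
      have := Real.log_le_sub_one_of_pos (show 0 < 1 + δ by linarith)
      linarith
    linarith
  have hk0 : (0 : ℝ) ≤ k₀ := by positivity
  have hden : 0 < 1 + (c + harm k₀) * k₀ := by positivity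
  have h := main (c / 2 / (1 + (c + harm k₀) * k₀)) (by positivity)
  have h6 := Real.add_one_le_exp (-(c / 2 / (1 + (c + harm k₀) * k₀) * k₀))
  have h7 : c / 2 / (1 + (c + harm k₀) * k₀) * (1 + (c + harm k₀) * k₀) = c / 2 :=
    div_mul_cancel₀ _ hden.ne'
  generalize c / 2 / (1 + (c + harm k₀) * k₀) = δ at *
  have h8 := mul_le_mul_of_nonneg_left h6 (show 0 ≤ c + harm k₀ by linarith)
  linarith

theorem exists_primeSum_le {ε : ℝ} (hε : 0 < ε) (Z : ℝ) :
    ∃ z, Z ≤ z ∧ primeSum z ≤ Real.log (Real.log z) + Real.eulerMascheroniConstant + ε := by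
  by_contra! hcon
  obtain ⟨k₁, hk₁⟩ := eventually_atTop.1
    (tendsto_harm_sub_log.eventually_lt_const
      (show Real.eulerMascheroniConstant < Real.eulerMascheroniConstant + ε / 2 by linarith))
  obtain ⟨k₂, hk₂⟩ := exists_nat_ge Z
  refine not_harm_add_le_primeSumExp (half_pos hε) (max k₁ k₂) fun k hk => ?_
  have h1 := hk₁ k ((le_max_left _ _).trans hk)
  have h2 : (k₂ : ℝ) ≤ k := by exact_mod_cast (le_max_right _ _).trans hk
  have h3 := hcon (Real.exp k) (by linarith [Real.add_one_le_exp (k : ℝ)])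
  rw [Real.log_exp] at h3
  rw [primeSumExp]
  linarith

theorem primeSum_le {x : ℝ} (hx : 90000 ≤ x) :
    primeSum x ≤ Chebyshev.psi x / (x * Real.log x) + Real.log (Real.log x)
      + Real.eulerMascheroniConstant - 1 / Real.log x + 33 / 1000 * kap x := by
  refine le_of_forall_pos_le_add fun ε hε => ?_
  obtain ⟨z, hz, hle⟩ := exists_primeSum_le (half_pos hε) (max x (Real.exp (2 / ε)))
  have h1 := primeSum_le_of_le hx (le_trans (le_max_left _ _) hz)
  have h2 : 2 / ε ≤ Real.log z :=
    (Real.le_log_iff_exp_le (by linarith [le_max_left x (Real.exp (2 / ε))])).2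
      (le_trans (le_max_right _ _) hz)
  have h3 : 1 / Real.log z ≤ 1 / (2 / ε) := one_div_le_one_div_of_le (by positivity) h2
  rw [one_div_div] at h3
  linarith

theorem neg_log_one_sub_le {y : ℝ} (h0 : 0 ≤ y) (h1 : y < 1) (K : ℕ) :
    -Real.log (1 - y) ≤ ∑ k ∈ Icc 1 K, y ^ k / k + y ^ (K + 1) / ((K + 1) * (1 - y)) := by
  have hy : 0 < 1 - y := by linarith
  have key : ∀ M : ℕ, ∑ k ∈ range (K + M), y ^ (k + 1) / (k + 1)
      + y ^ (K + M + 1) / ((K + 1) * (1 - y))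
      ≤ ∑ k ∈ range K, y ^ (k + 1) / (k + 1) + y ^ (K + 1) / ((K + 1) * (1 - y)) := by
    intro M
    induction M with
    | zero => simp
    | succ M ih =>
      refine le_trans ?_ ih
      rw [← add_assoc, Finset.sum_range_succ, add_assoc]
      refine add_le_add le_rfl ?_
      have e1 : y ^ (K + M + 1) / (((K + M : ℕ) : ℝ) + 1) ≤ y ^ (K + M + 1) / (K + 1) := by
        refine div_le_div_of_nonneg_left (by positivity) (by positivity) ?_
        push_cast
        linarith [(Nat.cast_nonneg M : (0 : ℝ) ≤ M)]
      have e2 : y ^ (K + M + 1) / (K + 1) + y ^ (K + M + 1 + 1) / ((K + 1) * (1 - y))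
          = y ^ (K + M + 1) / ((K + 1) * (1 - y)) := by
        field_simp
        ring
      linarith
  have hlim := (Real.hasSum_pow_div_log_of_abs_lt_one
      (abs_lt.2 ⟨by linarith, h1⟩)).tendsto_sum_nat
  have hK : ∑ k ∈ Icc 1 K, y ^ k / k = ∑ k ∈ range K, y ^ (k + 1) / (k + 1) := by
    clear key
    induction K with
    | zero => simp
    | succ K ih =>
      rw [Finset.sum_Icc_succ_top (by omega), ih, Finset.sum_range_succ]
      push_cast
      rfl
  rw [hK]
  refine le_of_tendsto hlim ?_
  filter_upwards [eventually_ge_atTop K] with k hk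
  obtain ⟨M, rfl⟩ := Nat.exists_eq_add_of_le hk
  refine le_trans ?_ (key M)
  have : 0 ≤ y ^ (K + M + 1) / ((K + 1) * (1 - y)) := by positivity
  linarith

theorem sum_Ioc_le_half_inv {s : ℕ} (hs : 1 ≤ s) (n : ℕ) (hn : s ≤ n) :
    ∑ p ∈ Ioc s n, 1 / (2 * (p : ℝ) * (p - 1)) ≤ 1 / (2 * s) - 1 / (2 * n) := by
  induction n, hn using Nat.le_induction with
  | base => simp
  | succ n hn ih =>
    rw [← Finset.insert_Ioc_right_eq_Ioc_add_one (by omega), Finset.sum_insert (by simp)]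
    have : (1 : ℝ) ≤ n := by exact_mod_cast hs.trans hn
    have e : 1 / (2 * ((n + 1 : ℕ) : ℝ) * ((n + 1 : ℕ) - 1)) = 1 / (2 * (n : ℝ)) - 1 / (2 * ((n + 1 : ℕ) : ℝ)) := by
      push_cast
      rw [add_sub_cancel_right]
      field_simp
      ring
    linarith

/-- Completing the prime powers up to `n` to full Euler factors costs `O(1 / √n)`. -/
theorem sum_neg_log_le_primeSum_add {n : ℕ} (hn : 4 ≤ n) :
    ∑ p ∈ n.primesLE, -Real.log (1 - (p : ℝ)⁻¹) ≤ primeSum n + 7 / (6 * n.sqrt) := by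
  set s := n.sqrt with hs
  have hs1 : 2 ≤ s := Nat.le_sqrt.2 (by omega)
  have hsn : s * s ≤ n := Nat.sqrt_le n
  have hns : n < (s + 1) * (s + 1) := Nat.lt_succ_sqrt n
  have hn0 : (0 : ℝ) < n := by positivity
  have hsle : s ≤ n := Nat.sqrt_le_self n
  have e1 : primeSum n = ∑ p ∈ n.primesLE, ∑ k ∈ Icc 1 (Nat.log p n), ((p : ℝ)⁻¹) ^ k / k := by
    have h := sum_vonMangoldt_div_log (fun m => 1 / (m : ℝ)) n
    rw [primeSum, Nat.floor_natCast]
    refine Eq.trans (Finset.sum_congr rfl fun m _ => ?_) (h.trans ?_)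
    · rw [div_mul_div_comm, mul_one, mul_comm]
    · refine Finset.sum_congr rfl fun p _ => Finset.sum_congr rfl fun k _ => ?_
      rw [Nat.cast_pow, one_div, inv_pow]
  have e2 : ∀ p ∈ n.primesLE, -Real.log (1 - (p : ℝ)⁻¹)
      ≤ ∑ k ∈ Icc 1 (Nat.log p n), ((p : ℝ)⁻¹) ^ k / k
        + if p ≤ s then 2 / (3 * (n : ℝ)) else 1 / (2 * (p : ℝ) * (p - 1)) := by
    intro p hp
    have hp2 : 2 ≤ p := Nat.two_le_of_mem_primesLE hp
    have hpn : p ≤ n := Nat.le_of_mem_primesLE hp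
    have hp2' : (2 : ℝ) ≤ p := by exact_mod_cast hp2
    have hy1 : (p : ℝ)⁻¹ ≤ 1 / 2 := by
      rw [← one_div]
      exact one_div_le_one_div_of_le (by norm_num) hp2'
    refine (neg_log_one_sub_le (by positivity) (by linarith) (Nat.log p n)).trans
      (add_le_add le_rfl ?_)
    split_ifs with h
    · have hK : 2 ≤ Nat.log p n := Nat.le_log_of_pow_le (by omega) (by nlinarith)
      have hK' : (2 : ℝ) ≤ (Nat.log p n : ℕ) := by exact_mod_cast hK
      have hlt : (n : ℝ) ≤ (p : ℝ) ^ (Nat.log p n + 1) := by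
        exact_mod_cast (Nat.lt_pow_succ_log_self (by omega) n).le
      rw [inv_pow]
      calc ((p : ℝ) ^ (Nat.log p n + 1))⁻¹ / (((Nat.log p n : ℕ) + 1) * (1 - (p : ℝ)⁻¹))
          ≤ (n : ℝ)⁻¹ / ((2 + 1) * (1 - 1 / 2)) := by
            refine div_le_div₀ (by positivity) (inv_anti₀ hn0 hlt) (by norm_num) ?_
            exact mul_le_mul (by linarith) (by linarith) (by norm_num) (by linarith)
        _ = 2 / (3 * (n : ℝ)) := by field_simp; norm_num
    · have hK : Nat.log p n = 1 := by
        refine Nat.log_eq_of_pow_le_of_lt_pow (by rwa [pow_one]) (hns.trans_le ?_)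
        rw [pow_two]
        exact Nat.mul_le_mul (by omega) (by omega)
      have : (p : ℝ) - 1 ≠ 0 := by linarith
      have h3 : (1 : ℝ) - (p : ℝ)⁻¹ = (p - 1) / p := by field_simp
      rw [hK, h3, inv_pow, Nat.cast_one]
      refine le_of_eq ?_
      norm_num
      field_simp
  refine (Finset.sum_le_sum e2).trans ?_
  rw [Finset.sum_add_distrib, ← e1]
  refine add_le_add le_rfl ?_
  have hsub : n.primesLE ⊆ Ioc 0 n := by
    rw [Nat.primesLE_eq_filter_Ioc_zero]
    exact filter_subset _ _
  have hnn : ∀ p ∈ Ioc 0 n, 0 ≤ (if p ≤ s then 2 / (3 * (n : ℝ)) else 1 / (2 * (p : ℝ) * (p - 1))) := by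
    intro p hp
    have : (1 : ℝ) ≤ p := by exact_mod_cast (mem_Ioc.1 hp).1
    have : (0 : ℝ) ≤ p - 1 := by linarith
    split_ifs <;> positivity
  refine (Finset.sum_le_sum_of_subset_of_nonneg hsub fun p hp _ => hnn p hp).trans ?_
  rw [← Finset.Ioc_union_Ioc_eq_Ioc (Nat.zero_le s) hsle, Finset.sum_union
    (Finset.disjoint_left.2 fun a h1 h2 => by simp only [mem_Ioc] at h1 h2; omega),
    Finset.sum_congr rfl (fun p hp => if_pos (mem_Ioc.1 hp).2),
    Finset.sum_congr rfl (fun p hp => if_neg (not_le.2 (mem_Ioc.1 hp).1))]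
  have h1 := sum_Ioc_le_half_inv (by omega : 1 ≤ s) n hsle
  rw [Finset.sum_const, Nat.card_Ioc, Nat.sub_zero, nsmul_eq_mul]
  have hs0 : (0 : ℝ) < s := by positivity
  have h2 : (s : ℝ) * (2 / (3 * (n : ℝ))) ≤ 2 / (3 * s) := by
    rw [mul_div_assoc', div_le_div_iff₀ (by positivity) (by positivity)]
    have : (s : ℝ) * s ≤ n := by exact_mod_cast hsn
    nlinarith
  have h3 : (0 : ℝ) ≤ 1 / (2 * n) := by positivity
  have h4 : 2 / (3 * (s : ℝ)) + 1 / (2 * s) = 7 / (6 * s) := by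
    field_simp
    norm_num
  linarith

theorem psi_sub_theta_le_mul {x : ℝ} (hx : 91750 ≤ x) :
    Chebyshev.psi x - Chebyshev.theta x ≤ 11 / 10000 * (x * Real.log x) := by
  have hx0 : 0 < x := by linarith
  have hL : 114 / 10 ≤ Real.log x := by
    have := log_large_numerals.2.1
    have h := Real.log_le_log (by norm_num) (show (90000 : ℝ) ≤ x by linarith)
    linarith
  have h0 := Chebyshev.psi_sub_theta_le_psi_add_psi_add_psi x
  have l4 : Real.log 4 ≤ 1387 / 1000 := by
    have := Real.log_two_lt_d9
    rw [show (4 : ℝ) = 2 ^ 2 by norm_num, Real.log_pow]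
    push_cast
    linarith
  set r := √x with hr
  have hrx : r * r = x := Real.mul_self_sqrt hx0.le
  have hr1 : 302 ≤ r := Real.le_sqrt_of_sq_le (by linarith)
  set q := √r with hq
  have hqr : q * q = r := Real.mul_self_sqrt (by linarith)
  have hq1 : 173 / 10 ≤ q := Real.le_sqrt_of_sq_le (by linarith)
  set c := x ^ (3 : ℝ)⁻¹ with hc
  have hcx : c ^ 3 = x := by
    rw [hc, ← Real.rpow_natCast, ← Real.rpow_mul hx0.le]
    norm_num
  have hc0 : 0 < c := Real.rpow_pos_of_pos hx0 _
  have hc1 : 45 ≤ c := by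
    by_contra! h
    have : c ^ 3 < 45 ^ 3 := pow_lt_pow_left₀ h hc0.le (by norm_num)
    linarith
  have h2 : x ^ (2 : ℝ)⁻¹ = r := by rw [hr, Real.sqrt_eq_rpow, one_div]
  have h5 : x ^ (5 : ℝ)⁻¹ ≤ c :=
    Real.rpow_le_rpow_of_exponent_le (by linarith) (by norm_num)
  rw [h2] at h0
  have e1 := Chebyshev.psi_sub_theta_le (show 1 ≤ r by linarith)
  have e2 := Chebyshev.theta_le_log4_mul_x (show 0 ≤ r by linarith)
  have e3 := Chebyshev.psi_le_const_mul_self hc0.le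
  have e4 := Chebyshev.psi_mono h5
  have e5 : Real.log r = Real.log x / 2 := by rw [hr, Real.log_sqrt hx0.le]
  rw [← hq, e5] at e1
  have e6 : r ≤ x / 302 := by rw [le_div_iff₀ (by norm_num)]; nlinarith
  have e7 : q ≤ r / (173 / 10) := by rw [le_div_iff₀ (by norm_num)]; nlinarith
  have e8 : c ≤ x / 2025 := by
    rw [le_div_iff₀ (by norm_num), ← hcx]
    nlinarith [mul_nonneg hc0.le (show 0 ≤ c ^ 2 - 2025 by nlinarith)]
  have f1 : Real.log 4 * r ≤ 1387 / 1000 * (x / 302) :=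
    mul_le_mul l4 e6 (by linarith) (by norm_num)
  have f2 : (Real.log 4 + 4) * c ≤ (1387 / 1000 + 4) * (x / 2025) :=
    mul_le_mul (by linarith) e8 hc0.le (by norm_num)
  have f3 : 2 * q * (Real.log x / 2) ≤ x / 302 / (173 / 10) * Real.log x := by
    have : q ≤ x / 302 / (173 / 10) := e7.trans (div_le_div_of_nonneg_right e6 (by norm_num))
    nlinarith
  have f4 : x * (114 / 10) ≤ x * Real.log x := mul_le_mul_of_nonneg_left hL hx0.le
  nlinarith

theorem sum_neg_log_le {n : ℕ} (hn : 91750 ≤ n) :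
    ∑ p ∈ n.primesLE, -Real.log (1 - (p : ℝ)⁻¹) ≤ Chebyshev.theta n / (n * Real.log n)
      + Real.log (Real.log n) + Real.eulerMascheroniConstant - 1 / Real.log n + 82 / 10000 := by
  have hx : (91750 : ℝ) ≤ n := by exact_mod_cast hn
  have h1 := sum_neg_log_le_primeSum_add (show 4 ≤ n by omega)
  have h2 := primeSum_le (show (90000 : ℝ) ≤ n by linarith)
  have h3 := psi_sub_theta_le_mul hx
  have hL : 114075 / 10000 ≤ Real.log n := by
    have := log_large_numerals.2.1
    have h := Real.log_le_log (by norm_num) (show (90000 : ℝ) ≤ n by linarith)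
    linarith
  have hs : (302 : ℝ) ≤ n.sqrt := by exact_mod_cast Nat.le_sqrt.2 (by omega)
  have h4 : 7 / (6 * (n.sqrt : ℝ)) ≤ 7 / (6 * 302) :=
    div_le_div_of_nonneg_left (by norm_num) (by norm_num) (by linarith)
  have h5 : kap n ≤ 1 / (114075 / 10000) + 1 / (114075 / 10000) ^ 2 := by
    rw [kap]
    exact add_le_add (one_div_le_one_div_of_le (by norm_num) hL)
      (one_div_le_one_div_of_le (by norm_num) (pow_le_pow_left₀ (by norm_num) hL 2))
  have hd : 0 < (n : ℝ) * Real.log n := by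
    have : 0 < Real.log n := by linarith
    positivity
  have h6 : Chebyshev.psi n / (n * Real.log n)
      ≤ Chebyshev.theta n / (n * Real.log n) + 11 / 10000 := by
    rw [div_add' _ _ _ hd.ne']
    exact div_le_div_of_nonneg_right (by linarith) hd.le
  norm_num at h4 h5
  linarith

/-- The divisor sum `1 + p + ⋯ + p ^ a` of a prime power. -/
def sig (p : ℕ) : ℕ → ℕ
  | 0 => 1
  | a + 1 => p * sig p a + 1

theorem sig_zero (p : ℕ) : sig p 0 = 1 := rfl

theorem sig_succ (p a : ℕ) : sig p (a + 1) = p * sig p a + 1 := rfl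

theorem sig_eq_sum (p a : ℕ) : sig p a = ∑ i ∈ range (a + 1), p ^ i := by
  induction a with
  | zero => simp [sig]
  | succ a ih =>
    rw [Finset.sum_range_succ', sig, ih, Finset.mul_sum, pow_zero]
    congr 1
    exact Finset.sum_congr rfl fun i _ => (pow_succ' p i).symm

theorem sig_pos (p a : ℕ) : 0 < sig p a := by
  cases a with
  | zero => simp [sig_zero]
  | succ a => rw [sig_succ]; omega

theorem sum_divisors_eq_prod_sig {N : ℕ} (hN : N ≠ 0) :
    ∑ d ∈ N.divisors, d = ∏ p ∈ N.primeFactors, sig p (N.factorization p) := by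
  simp only [Nat.sum_divisors hN, sig_eq_sum]

/-- A Lagrangian upper bound for `σ(N) / N` over `7`-free integers. -/
theorem log_sum_divisors_le {N : ℕ} (hN : N ≠ 0) (hfree : ∀ p : ℕ, p.Prime → ¬ p ^ 7 ∣ N)
    (l : ℝ) (S : Finset ℕ) (f : ℕ → ℝ) (hf : ∀ p ∈ S, 0 ≤ f p)
    (h : ∀ p a : ℕ, p.Prime → 1 ≤ a → a ≤ 6 →
      Real.log (sig p a) - (1 + l) * (a * Real.log p) ≤ if p ∈ S then f p else 0) :
    Real.log ((∑ d ∈ N.divisors, d : ℕ) : ℝ) ≤ ∑ p ∈ S, f p + (1 + l) * Real.log N := by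
  have h1 : Real.log ((∑ d ∈ N.divisors, d : ℕ) : ℝ)
      = ∑ p ∈ N.primeFactors, Real.log (sig p (N.factorization p)) := by
    rw [sum_divisors_eq_prod_sig hN, Nat.cast_prod, Real.log_prod]
    intro p _
    exact_mod_cast (sig_pos _ _).ne'
  have h2 : Real.log N = ∑ p ∈ N.primeFactors, N.factorization p * Real.log p := by
    rw [Real.log_nat_eq_sum_factorization, Finsupp.sum, Nat.support_factorization]
  have h3 : ∑ p ∈ N.primeFactors, (Real.log (sig p (N.factorization p))
      - (1 + l) * (N.factorization p * Real.log p)) ≤ ∑ p ∈ S, f p := by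
    refine (Finset.sum_le_sum fun p hp => h p _ (Nat.prime_of_mem_primeFactors hp) ?_ ?_).trans ?_
    · exact (Nat.prime_of_mem_primeFactors hp).factorization_pos_of_dvd hN
        (Nat.dvd_of_mem_primeFactors hp)
    · have hpp := Nat.prime_of_mem_primeFactors hp
      by_contra! hlt
      exact hfree p hpp ((hpp.pow_dvd_iff_le_factorization hN).2 hlt)
    · rw [← Finset.sum_filter]
      refine Finset.sum_le_sum_of_subset_of_nonneg (fun p hp => (mem_filter.1 hp).2)
        fun p hp _ => hf p hp
  rw [Finset.sum_sub_distrib, ← Finset.mul_sum, ← h1, ← h2] at h3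
  linarith

theorem log_sig_le {p : ℕ} (hp : 2 ≤ p) (a : ℕ) :
    Real.log (sig p a) - a * Real.log p ≤ -Real.log (1 - (p : ℝ)⁻¹) := by
  have hp0 : (2 : ℝ) ≤ p := by exact_mod_cast hp
  have h1 : (sig p a : ℝ) * (p - 1) ≤ p ^ a * p := by
    have := geom_sum_mul (p : ℝ) (a + 1)
    rw [sig_eq_sum]
    push_cast
    rw [this, pow_succ]
    linarith
  have hs : (0 : ℝ) < sig p a := by exact_mod_cast sig_pos p a
  have h2 := Real.log_le_log (mul_pos hs (by linarith)) h1
  rw [Real.log_mul hs.ne' (by linarith), Real.log_mul (by positivity) (by linarith),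
    Real.log_pow] at h2
  have h3 : (1 : ℝ) - (p : ℝ)⁻¹ = (p - 1) / p := by field_simp
  rw [h3, Real.log_div (by linarith) (by linarith)]
  linarith

theorem log_sig_two_le {a : ℕ} (ha : a ≤ 6) :
    Real.log (sig 2 a) - a * Real.log (2 : ℕ)
      ≤ -Real.log (1 - ((2 : ℕ) : ℝ)⁻¹) + Real.log (127 / 128) := by
  have h : (sig 2 a : ℝ) ≤ 2 ^ a * (127 / 64) := by
    interval_cases a <;> norm_num [sig, Finset.sum_range_succ]
  have hs : (0 : ℝ) < sig 2 a := by exact_mod_cast sig_pos 2 a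
  have h2 := Real.log_le_log hs h
  rw [Real.log_mul (by positivity) (by norm_num), Real.log_pow] at h2
  have h3 : -Real.log (1 - ((2 : ℕ) : ℝ)⁻¹) + Real.log (127 / 128) = Real.log (127 / 64) := by
    rw [← Real.log_inv, ← Real.log_mul (by norm_num) (by norm_num)]
    norm_num
  rw [h3]
  push_cast
  linarith

theorem log_sig_three_le {a : ℕ} (ha : a ≤ 6) :
    Real.log (sig 3 a) - a * Real.log (3 : ℕ)
      ≤ -Real.log (1 - ((3 : ℕ) : ℝ)⁻¹) + Real.log (2186 / 2187) := by
  have h : (sig 3 a : ℝ) ≤ 3 ^ a * (1093 / 729) := by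
    interval_cases a <;> norm_num [sig, Finset.sum_range_succ]
  have hs : (0 : ℝ) < sig 3 a := by exact_mod_cast sig_pos 3 a
  have h2 := Real.log_le_log hs h
  rw [Real.log_mul (by positivity) (by norm_num), Real.log_pow] at h2
  have h3 : -Real.log (1 - ((3 : ℕ) : ℝ)⁻¹) + Real.log (2186 / 2187) = Real.log (1093 / 729) := by
    rw [← Real.log_inv, ← Real.log_mul (by norm_num) (by norm_num)]
    norm_num
  rw [h3]
  push_cast
  linarith

theorem log_correction_le : Real.log (127 / 128) + Real.log (2186 / 2187) ≤ -(829 / 100000) := by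
  have h1 := log_sub_log_le (show (0 : ℝ) < 128 by norm_num) (show (0 : ℝ) < 127 by norm_num)
  have h2 := Real.log_le_sub_one_of_pos (show (0 : ℝ) < 2186 / 2187 by norm_num)
  have h3 := two_div_le_log_succ_sub (show 0 < 127 by norm_num)
  rw [Real.log_div (by norm_num) (by norm_num)]
  norm_num at h1 h2 h3
  linarith

theorem log_sum_divisors_lt_of_large {N : ℕ} (hfree : ∀ p : ℕ, p.Prime → ¬ p ^ 7 ∣ N)
    (hlarge : 91750 ≤ Real.log N) :
    Real.log ((∑ d ∈ N.divisors, d : ℕ) : ℝ)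
      < Real.eulerMascheroniConstant + Real.log N + Real.log (Real.log (Real.log N)) := by
  have hN : N ≠ 0 := by
    rintro rfl
    norm_num at hlarge
  set n := ⌊Real.log N⌋₊ with hn
  have hn1 : 91750 ≤ n := Nat.le_floor (by exact_mod_cast hlarge)
  have hnL : (n : ℝ) ≤ Real.log N := Nat.floor_le (by linarith)
  have hLn : Real.log N < n + 1 := Nat.lt_floor_add_one _
  have hnR : (91750 : ℝ) ≤ n := by exact_mod_cast hn1
  have hL : 114 / 10 ≤ Real.log n := by
    have := log_large_numerals.2.1
    have h := Real.log_le_log (by norm_num) (show (90000 : ℝ) ≤ n by linarith)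
    linarith
  set l := 1 / ((n : ℝ) * Real.log n) with hl
  have hl0 : 0 < l := by
    have : 0 < Real.log n := by linarith
    positivity
  have hln : l * Real.log n = 1 / n := by
    rw [hl]
    have : Real.log n ≠ 0 := by linarith
    field_simp
  set f : ℕ → ℝ := fun p => -Real.log (1 - (p : ℝ)⁻¹)
    + ((if p = 2 then Real.log (127 / 128) else 0) + if p = 3 then Real.log (2186 / 2187) else 0)
    - l * Real.log p with hf
  have hle : ∀ p a : ℕ, p.Prime → 1 ≤ a → a ≤ 6 →
      Real.log (sig p a) - (1 + l) * (a * Real.log p) ≤ f p := by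
    intro p a hp ha ha6
    have hlp : 0 ≤ Real.log p := Real.log_natCast_nonneg p
    have ha' : (1 : ℝ) ≤ a := by exact_mod_cast ha
    have h1 : l * Real.log p ≤ l * (a * Real.log p) :=
      mul_le_mul_of_nonneg_left (by nlinarith) hl0.le
    have h2 : Real.log (sig p a) - a * Real.log p ≤ -Real.log (1 - (p : ℝ)⁻¹)
      + ((if p = 2 then Real.log (127 / 128) else 0)
        + if p = 3 then Real.log (2186 / 2187) else 0) := by
      by_cases h2 : p = 2
      · subst h2
        simpa using log_sig_two_le ha6
      by_cases h3 : p = 3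
      · subst h3
        simpa using log_sig_three_le ha6
      simpa [h2, h3] using log_sig_le hp.two_le a
    simp only [hf]
    linarith
  have hf0 : ∀ p ∈ n.primesLE, 0 ≤ f p := by
    intro p hp
    have hp' := Nat.prime_of_mem_primesLE hp
    have hpn : (p : ℝ) ≤ n := by exact_mod_cast Nat.le_of_mem_primesLE hp
    have hp0 : (0 : ℝ) < p := by exact_mod_cast hp'.pos
    have h3 : l * Real.log p ≤ 1 / n :=
      hln ▸ mul_le_mul_of_nonneg_left (Real.log_le_log hp0 hpn) hl0.le
    by_cases hp3 : p ≤ 3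
    · refine le_trans ?_ (hle p 1 hp' le_rfl (by norm_num))
      have hp3' : (p : ℝ) ≤ 3 := by exact_mod_cast hp3
      have h2 := inv_succ_le_log_succ_sub hp0
      have h4 : (sig p 1 : ℝ) = p + 1 := by rw [sig_succ, sig_zero]; push_cast; ring
      have h5 : (1 : ℝ) / n ≤ 1 / (p + 1) := one_div_le_one_div_of_le (by linarith) (by linarith)
      rw [h4]
      push_cast
      linarith
    · have h2 : Real.log (1 - (p : ℝ)⁻¹) ≤ 1 - (p : ℝ)⁻¹ - 1 := by
        refine Real.log_le_sub_one_of_pos ?_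
        have : (p : ℝ)⁻¹ < 1 := inv_lt_one_of_one_lt₀ (by exact_mod_cast hp'.one_lt)
        linarith
      have h4 : (1 : ℝ) / n ≤ (p : ℝ)⁻¹ := by
        rw [← one_div]
        exact one_div_le_one_div_of_le hp0 hpn
      simp only [hf, if_neg (show p ≠ 2 by omega), if_neg (show p ≠ 3 by omega)]
      linarith
  have hmain := log_sum_divisors_le hN hfree l n.primesLE f hf0 (by
    intro p a hp ha ha6
    split_ifs with hpS
    · exact hle p a hp ha ha6
    have hpn : n + 1 ≤ p := by
      by_contra! h
      exact hpS (Nat.mem_primesLE.2 ⟨by omega, hp⟩)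
    have hpn' : (n : ℝ) + 1 ≤ p := by exact_mod_cast hpn
    have h1 := log_sig_le hp.two_le a
    have h2 : -Real.log (1 - (p : ℝ)⁻¹) ≤ 1 / n := by
      have h3 : (1 : ℝ) - (p : ℝ)⁻¹ = (p - 1) / p := by
        have : (p : ℝ) ≠ 0 := by linarith
        field_simp
      rw [h3, Real.log_div (by linarith) (by linarith)]
      have h4 := log_sub_log_le (show (0 : ℝ) < p - 1 by linarith) (show (0 : ℝ) < p by linarith)
      have h5 : (p - (p - 1) : ℝ) / (p - 1) ≤ 1 / n := by
        rw [sub_sub_cancel]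
        exact one_div_le_one_div_of_le (by linarith) (by linarith)
      linarith
    have h6 : Real.log n ≤ Real.log p := Real.log_le_log (by linarith) (by linarith)
    have h7 : l * Real.log n ≤ l * (a * Real.log p) := by
      refine mul_le_mul_of_nonneg_left ?_ hl0.le
      have ha' : (1 : ℝ) ≤ a := by exact_mod_cast ha
      nlinarith
    linarith)
  have hsum : ∑ p ∈ n.primesLE, f p = ∑ p ∈ n.primesLE, -Real.log (1 - (p : ℝ)⁻¹)
      + (Real.log (127 / 128) + Real.log (2186 / 2187)) - l * Chebyshev.theta n := by
    simp only [hf]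
    rw [Finset.sum_sub_distrib, Finset.sum_add_distrib, Finset.sum_add_distrib, ← Finset.mul_sum,
      Chebyshev.theta_eq_sum_primesLE_log, Finset.sum_ite_eq', Finset.sum_ite_eq',
      if_pos (Nat.mem_primesLE.2 ⟨by omega, Nat.prime_two⟩),
      if_pos (Nat.mem_primesLE.2 ⟨by omega, Nat.prime_three⟩)]
  have hM := sum_neg_log_le hn1
  have hc := log_correction_le
  have h8 : Chebyshev.theta n / (n * Real.log n) = l * Chebyshev.theta n := by
    rw [hl]; ring
  have h9 : l * Real.log N ≤ 1 / Real.log n + 1 / 1000000 := by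
    have e1 : l * Real.log N ≤ l * (n + 1) := mul_le_mul_of_nonneg_left hLn.le hl0.le
    have e2 : l * (n + 1) = 1 / Real.log n + l := by
      rw [hl]
      have : Real.log n ≠ 0 := by linarith
      field_simp
    have e3 : l ≤ 1 / 1000000 := one_div_le_one_div_of_le (by norm_num) (by nlinarith)
    linarith
  have h10 : Real.log (Real.log n) ≤ Real.log (Real.log (Real.log N)) :=
    Real.log_le_log (by linarith) (Real.log_le_log (by linarith) hnL)
  rw [hsum] at hmain
  linarith

theorem log_sig_succ_sub_le {n b : ℕ} (hn : 2 ≤ n) :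
    Real.log (sig n (b + 1)) - Real.log (sig n b) - Real.log n ≤ 1 / (n * sig n b : ℕ) := by
  have hs := sig_pos n b
  have hm : (0 : ℝ) < (n * sig n b : ℕ) := by
    exact_mod_cast Nat.mul_pos (by omega) hs
  have h := log_sub_log_le hm (show (0 : ℝ) < (n * sig n b : ℕ) + 1 by linarith)
  rw [add_sub_cancel_left] at h
  have h2 : Real.log (n * sig n b : ℕ) = Real.log n + Real.log (sig n b) := by
    rw [Nat.cast_mul, Real.log_mul (by positivity) (by exact_mod_cast hs.ne')]
  rw [sig_succ, Nat.cast_add, Nat.cast_one]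
  linarith

theorem le_log_sig_succ_sub {n b : ℕ} (hn : 2 ≤ n) :
    2 / (2 * (n * sig n b : ℕ) + 1)
      ≤ Real.log (sig n (b + 1)) - Real.log (sig n b) - Real.log n := by
  have hs := sig_pos n b
  have hm : (0 : ℝ) < (n * sig n b : ℕ) := by
    exact_mod_cast Nat.mul_pos (by omega) hs
  have h := two_div_le_log_succ_sub hm
  have h2 : Real.log (n * sig n b : ℕ) = Real.log n + Real.log (sig n b) := by
    rw [Nat.cast_mul, Real.log_mul (by positivity) (by exact_mod_cast hs.ne')]
  rw [sig_succ, Nat.cast_add, Nat.cast_one]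
  linarith

theorem sig_mono {n : ℕ} (hn : 2 ≤ n) : Monotone (sig n) := by
  refine monotone_nat_of_le_succ fun b => ?_
  rw [sig_succ]
  nlinarith [sig_pos n b]

/-- The exponent `a` maximizes the local Lagrangian once no unit step improves it. -/
theorem log_sig_sub_le_of_steps {n a c : ℕ} {l : ℝ} (hn : 2 ≤ n)
    (hlow : 1 ≤ a → l * Real.log n ≤ 2 / (2 * (n * sig n (a - 1) : ℕ) + 1))
    (hup : a < 6 → 1 / (n * sig n a : ℕ) ≤ l * Real.log n) (hc : c ≤ 6) :
    Real.log (sig n c) - (1 + l) * (c * Real.log n)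
      ≤ Real.log (sig n a) - (1 + l) * (a * Real.log n) := by
  have hpos : ∀ b, (0 : ℝ) < (n * sig n b : ℕ) := fun b => by
    exact_mod_cast Nat.mul_pos (by omega) (sig_pos n b)
  have hmono : ∀ b b', b ≤ b' → ((n * sig n b : ℕ) : ℝ) ≤ (n * sig n b' : ℕ) := fun b b' h => by
    exact_mod_cast Nat.mul_le_mul_left n (sig_mono hn h)
  have below : ∀ d, c + d ≤ a → Real.log (sig n c) - (1 + l) * (c * Real.log n)
      ≤ Real.log (sig n (c + d)) - (1 + l) * ((c + d : ℕ) * Real.log n) := by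
    intro d
    induction d with
    | zero => intro _; exact le_rfl
    | succ d ih =>
      intro hd
      refine (ih (by omega)).trans ?_
      have h1 := hlow (by omega)
      have h2 := le_log_sig_succ_sub (b := c + d) hn
      have h3 : (2 : ℝ) / (2 * (n * sig n (a - 1) : ℕ) + 1) ≤ 2 / (2 * (n * sig n (c + d) : ℕ) + 1) := by
        have := hmono (c + d) (a - 1) (by omega)
        have := hpos (c + d)
        exact div_le_div_of_nonneg_left (by norm_num) (by linarith) (by linarith)
      rw [← add_assoc, Nat.cast_add_one]
      linarith
  have above : ∀ d, a + d ≤ 6 → Real.log (sig n (a + d)) - (1 + l) * ((a + d : ℕ) * Real.log n)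
      ≤ Real.log (sig n a) - (1 + l) * (a * Real.log n) := by
    intro d
    induction d with
    | zero => intro _; exact le_rfl
    | succ d ih =>
      intro hd
      refine le_trans ?_ (ih (by omega))
      have h1 := hup (by omega)
      have h2 := log_sig_succ_sub_le (b := a + d) hn
      have h3 : (1 : ℝ) / (n * sig n (a + d) : ℕ) ≤ 1 / (n * sig n a : ℕ) :=
        one_div_le_one_div_of_le (hpos a) (hmono a (a + d) (by omega))
      rw [← add_assoc, Nat.cast_add_one]
      linarith
  rcases le_total c a with h | h
  · obtain ⟨d, rfl⟩ := Nat.exists_eq_add_of_le h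
    exact below d le_rfl
  · obtain ⟨d, rfl⟩ := Nat.exists_eq_add_of_le h
    exact above d hc

/-- The primes below `512`. -/
def smallPrimes : List ℕ :=
  [2, 3, 5, 7, 11, 13, 17, 19, 23, 29, 31, 37, 41, 43, 47, 53, 59, 61, 67, 71, 73, 79, 83, 89, 97,
   101, 103, 107, 109, 113, 127, 131, 137, 139, 149, 151, 157, 163, 167, 173, 179, 181, 191, 193,
   197, 199, 211, 223, 227, 229, 233, 239, 241, 251, 257, 263, 269, 271, 277, 281, 283, 293, 307,
   311, 313, 317, 331, 337, 347, 349, 353, 359, 367, 373, 379, 383, 389, 397, 401, 409, 419, 421,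
   431, 433, 439, 443, 449, 457, 461, 463, 467, 479, 487, 491, 499, 503, 509]

theorem smallPrimes_bounds : ∀ p ∈ smallPrimes, 2 ≤ p ∧ p < 512 := by decide +kernel

theorem smallPrimes_nodup : smallPrimes.Nodup := by decide +kernel

theorem mem_smallPrimes {p : ℕ} (hp : p.Prime) (h : p < 512) : p ∈ smallPrimes := by
  have key : ∀ n < 512, n < 2 ∨ n ∈ smallPrimes ∨
      ∃ d ∈ [2, 3, 5, 7, 11, 13, 17, 19], d < n ∧ n % d = 0 := by decide +kernel
  rcases key p h with h2 | h2 | ⟨d, hd, hdp, hmod⟩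
  · exact absurd hp.two_le (by omega)
  · exact h2
  · exfalso
    have h2 : 2 ≤ d := by
      have : ∀ d ∈ [2, 3, 5, 7, 11, 13, 17, 19], 2 ≤ d := by decide
      exact this d hd
    rcases (Nat.dvd_prime hp).1 (Nat.dvd_of_mod_eq_zero hmod) with h | h <;> omega

/-- The product of `smallPrimes`, in evaluated form. -/
def roughModulus : ℕ :=
  31964081287196888554640742530273949712805599189441373009521636182430667982828077742788853029807931798207106885718293402541861369758591699412090677759187666930105491469725350718941073722934985042092154205321144030

theorem roughModulus_eq : roughModulus = smallPrimes.prod := by decide +kernel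

/-- A positive integer coprime to all primes below `512`. -/
def Rough (n : ℕ) : Prop := Nat.gcd n smallPrimes.prod = 1

instance : DecidablePred Rough := fun n => inferInstanceAs (Decidable (Nat.gcd n _ = 1))

theorem rough_of_prime {p : ℕ} (hp : p.Prime) (h : 512 ≤ p) : Rough p := by
  refine (Nat.Prime.coprime_iff_not_dvd hp).2 fun hd => ?_
  obtain ⟨q, hq, hpq⟩ := (hp.prime.dvd_prod_iff).1 hd
  have := smallPrimes_bounds q hq
  exact absurd (Nat.le_of_dvd (by omega) hpq) (by omega)

/-- The integers in `[512, X)` without prime factors below `512`. -/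
def roughs (X : ℕ) : Finset ℕ := (Ico 512 X).filter Rough

structure RoughBound (X : ℕ) (R T : ℝ) : Prop where
  pos : 0 < R
  ratio : ∑ n ∈ roughs X, (Real.log (n + 1 : ℕ) - Real.log n) ≤ Real.log R
  size : T * Real.log 2 ≤ ∑ n ∈ roughs X, Real.log n

theorem roughBound_of_le {X : ℕ} (hX : X ≤ 512) : RoughBound X 1 0 := by
  have : roughs X = ∅ := by rw [roughs, Finset.Ico_eq_empty_of_le hX, Finset.filter_empty]
  exact ⟨one_pos, by simp [this], by simp [this]⟩

def treeProd (f : ℕ → ℕ) : ℕ → ℕ → ℕ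
  | 0, a => f a
  | d + 1, a => treeProd f d a * treeProd f d (a + 2 ^ d)

theorem treeProd_eq (f : ℕ → ℕ) (d a : ℕ) : treeProd f d a = ∏ n ∈ Ico a (a + 2 ^ d), f n := by
  induction d generalizing a with
  | zero => simp [treeProd]
  | succ d ih =>
    rw [treeProd, ih, ih, Finset.prod_Ico_consecutive _ (Nat.le_add_right _ _) (Nat.le_add_right _ _)]
    congr 2
    ring

def roughPart (M n : ℕ) : ℕ := bif Nat.beq (Nat.gcd n M) 1 then n else 1

def roughPartSucc (M n : ℕ) : ℕ := bif Nat.beq (Nat.gcd n M) 1 then n + 1 else 1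

theorem log_treeProd_roughPart (i : ℕ) :
    Real.log (treeProd (roughPart roughModulus) i (2 ^ i) : ℕ)
      = ∑ n ∈ (Ico (2 ^ i) (2 ^ (i + 1))).filter Rough, Real.log n := by
  rw [roughModulus_eq, treeProd_eq, Nat.cast_prod, Real.log_prod, Finset.sum_filter, pow_succ, mul_two]
  · refine Finset.sum_congr rfl fun n _ => ?_
    rw [roughPart]
    by_cases h : Rough n
    · rw [if_pos h, show Nat.gcd n smallPrimes.prod = 1 from h]
      rfl
    · have hb : Nat.beq (Nat.gcd n smallPrimes.prod) 1 = false :=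
        Bool.eq_false_iff.2 fun e => h (Nat.eq_of_beq_eq_true e)
      rw [if_neg h, hb]
      simp
  · intro n hn
    have : 0 < n := lt_of_lt_of_le (by positivity) (mem_Ico.1 hn).1
    rw [roughPart]
    cases Nat.beq (Nat.gcd n smallPrimes.prod) 1
    · simp
    · simp [this.ne']

theorem log_treeProd_roughPartSucc (i : ℕ) :
    Real.log (treeProd (roughPartSucc roughModulus) i (2 ^ i) : ℕ)
      = ∑ n ∈ (Ico (2 ^ i) (2 ^ (i + 1))).filter Rough, Real.log (n + 1 : ℕ) := by
  rw [roughModulus_eq, treeProd_eq, Nat.cast_prod, Real.log_prod, Finset.sum_filter, pow_succ, mul_two]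
  · refine Finset.sum_congr rfl fun n _ => ?_
    rw [roughPartSucc]
    by_cases h : Rough n
    · rw [if_pos h, show Nat.gcd n smallPrimes.prod = 1 from h]
      rfl
    · have hb : Nat.beq (Nat.gcd n smallPrimes.prod) 1 = false :=
        Bool.eq_false_iff.2 fun e => h (Nat.eq_of_beq_eq_true e)
      rw [if_neg h, hb]
      simp
  · intro n hn
    rw [roughPartSucc]
    cases Nat.beq (Nat.gcd n smallPrimes.prod) 1
    · simp
    · simpa using Nat.cast_add_one_ne_zero (R := ℝ) n

theorem treeProd_pos {f : ℕ → ℕ} {d a : ℕ} (h : ∀ n, a ≤ n → 0 < f n) : 0 < treeProd f d a := by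
  rw [treeProd_eq]
  exact Finset.prod_pos fun n hn => h n (mem_Ico.1 hn).1

theorem RoughBound.step {i : ℕ} {R T : ℝ} (h : RoughBound (2 ^ i) R T) (hi : 9 ≤ i) (r b : ℕ)
    (hr : 10 ^ 9 * treeProd (roughPartSucc roughModulus) i (2 ^ i)
      ≤ r * treeProd (roughPart roughModulus) i (2 ^ i))
    (hb : 2 ^ b ≤ treeProd (roughPart roughModulus) i (2 ^ i)) :
    RoughBound (2 ^ (i + 1)) (R * (r / 10 ^ 9)) (T + b) := by
  have hden : 0 < treeProd (roughPart roughModulus) i (2 ^ i) := lt_of_lt_of_le (by positivity) hb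
  have hnum : 0 < treeProd (roughPartSucc roughModulus) i (2 ^ i) := by
    refine treeProd_pos fun n _ => ?_
    rw [roughPartSucc]
    cases Nat.beq (Nat.gcd n roughModulus) 1 <;> simp
  have hr0 : 0 < r := by
    rcases Nat.eq_zero_or_pos r with h0 | h0
    · rw [h0, zero_mul] at hr
      have : 0 < 10 ^ 9 * treeProd (roughPartSucc roughModulus) i (2 ^ i) := by positivity
      omega
    · exact h0
  have hsplit : roughs (2 ^ (i + 1)) = (roughs (2 ^ i)) ∪ (Ico (2 ^ i) (2 ^ (i + 1))).filter Rough := by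
    have h9 : 512 ≤ 2 ^ i := (Nat.pow_le_pow_right (by norm_num) hi : 2 ^ 9 ≤ 2 ^ i)
    rw [roughs, roughs, ← Finset.filter_union, Finset.Ico_union_Ico_eq_Ico h9
      (Nat.pow_le_pow_right (by norm_num) (by omega))]
  have hdis : Disjoint (roughs (2 ^ i)) ((Ico (2 ^ i) (2 ^ (i + 1))).filter Rough) := by
    refine Finset.disjoint_left.2 fun n h1 h2 => ?_
    have e1 := (mem_Ico.1 (mem_filter.1 h1).1).2
    have e2 := (mem_Ico.1 (mem_filter.1 h2).1).1
    omega
  have hR := h.pos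
  refine ⟨by positivity, ?_, ?_⟩
  · rw [hsplit, Finset.sum_union hdis, Real.log_mul hR.ne' (by positivity)]
    refine add_le_add h.ratio ?_
    rw [Finset.sum_sub_distrib, ← log_treeProd_roughPart i,
      ← log_treeProd_roughPartSucc i, ← Real.log_div (by positivity) (by positivity)]
    refine Real.log_le_log (by positivity) ?_
    rw [div_le_div_iff₀ (by positivity) (by positivity), mul_comm]
    exact_mod_cast hr
  · rw [hsplit, Finset.sum_union hdis, add_mul]
    refine add_le_add h.size ?_
    rw [← log_treeProd_roughPart i, ← Real.log_pow]
    exact Real.log_le_log (by positivity) (by exact_mod_cast hb)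

theorem RoughBound.mono {X : ℕ} {R R' T T' : ℝ} (h : RoughBound X R T) (hR : R ≤ R')
    (hT : T' ≤ T) : RoughBound X R' T' :=
  ⟨h.pos.trans_le hR, h.ratio.trans (Real.log_le_log h.pos hR),
    (mul_le_mul_of_nonneg_right hT (Real.log_nonneg (by norm_num))).trans h.size⟩

/-- The integer part of `log₂ n` for `0 < n < 2 ^ 2 ^ i`, by binary search. -/
def bitsAux : ℕ → ℕ → ℕ
  | 0, _ => 0
  | i + 1, n => bif Nat.ble (2 ^ 2 ^ i) n then bitsAux i (n / 2 ^ 2 ^ i) + 2 ^ i else bitsAux i n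

/-- The integer part of `log₂ (p ^ 1024)` for `p < 512`. -/
def bits (p : ℕ) : ℕ := bitsAux 14 (p ^ 1024)

/-- A numerical test for the integer part of `log₂ (p ^ 1024)`. -/
def isBits (p b : ℕ) : Bool := Nat.ble (2 ^ b) (p ^ 1024) && Nat.ble (p ^ 1024) (2 ^ (b + 1))

theorem mul_log_two_le_of_isBits {p b : ℕ} (h : isBits p b = true) :
    b * Real.log 2 ≤ 1024 * Real.log p := by
  simp only [isBits, Bool.and_eq_true, Nat.ble_eq] at h
  have h2 := Real.log_le_log (by positivity)
    (show (2 : ℝ) ^ b ≤ (p : ℝ) ^ 1024 by exact_mod_cast h.1)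
  rw [Real.log_pow, Real.log_pow] at h2
  exact_mod_cast h2

theorem log_le_succ_mul_of_isBits {p b : ℕ} (hp : 0 < p) (h : isBits p b = true) :
    1024 * Real.log p ≤ (b + 1) * Real.log 2 := by
  simp only [isBits, Bool.and_eq_true, Nat.ble_eq] at h
  have h2 := Real.log_le_log (by positivity)
    (show (p : ℝ) ^ 1024 ≤ (2 : ℝ) ^ (b + 1) by exact_mod_cast h.2)
  rw [Real.log_pow, Real.log_pow] at h2
  exact_mod_cast h2

/-- The exponent of `p` in the maximizer: the number of initial entries of the decreasing
list `s` exceeding `p`. -/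
def expo : List ℕ → ℕ → ℕ
  | [], _ => 0
  | t :: s, p => bif Nat.blt p t then expo s p + 1 else 0

/-- A numerical test for the optimality of the exponent `a` of `p` for the parameter
`1 / (k log 2)`. -/
def optimal (k p a : ℕ) : Bool :=
  isBits p (bits p) && Nat.ble 1 a && Nat.ble ((2 * sig p a - 1) * (bits p + 1)) (2048 * k) &&
    (Nat.ble 6 a || Nat.ble (1024 * k) ((sig p (a + 1) - 1) * bits p))

theorem log_sig_sub_le_of_optimal {k p a c : ℕ} (hp : 2 ≤ p) (hk : 0 < k)
    (h : optimal k p a = true) (hc : c ≤ 6) :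
    Real.log (sig p c) - (1 + 1 / (k * Real.log 2)) * (c * Real.log p)
      ≤ Real.log (sig p a) - (1 + 1 / (k * Real.log 2)) * (a * Real.log p) := by
  simp only [optimal, Bool.and_eq_true, Bool.or_eq_true, Nat.ble_eq] at h
  obtain ⟨⟨⟨h0, h1⟩, h2⟩, h3⟩ := h
  have hl2 : 0 < Real.log 2 := Real.log_pos (by norm_num)
  have hk' : (0 : ℝ) < k := by exact_mod_cast hk
  have hkl : 0 < k * Real.log 2 := by positivity
  refine log_sig_sub_le_of_steps hp (fun _ => ?_) (fun h6 => ?_) hc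
  · obtain ⟨b, rfl⟩ : ∃ b, a = b + 1 := ⟨a - 1, by omega⟩
    rw [sig_succ] at h2
    rw [Nat.add_sub_cancel, one_div_mul_eq_div, div_le_div_iff₀ hkl (by positivity)]
    have e : 2 * (p * sig p b + 1) - 1 = 2 * (p * sig p b) + 1 := by omega
    rw [e] at h2
    have h2' : (2 * ((p * sig p b : ℕ) : ℝ) + 1) * (bits p + 1) ≤ 2048 * k := by exact_mod_cast h2
    have h4 := log_le_succ_mul_of_isBits (show 0 < p by omega) h0
    set m : ℝ := 2 * ((p * sig p b : ℕ) : ℝ) + 1 with hm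
    have hm0 : 0 < m := by positivity
    have h5 := mul_le_mul_of_nonneg_left h4 hm0.le
    have h6 := mul_le_mul_of_nonneg_right h2' hl2.le
    linarith
  · have h3' : 1024 * k ≤ (p * sig p a) * bits p := by
      rcases h3 with h3 | h3
      · omega
      · rwa [sig_succ, Nat.add_sub_cancel] at h3
    have hm0 : (0 : ℝ) < (p * sig p a : ℕ) := by
      exact_mod_cast Nat.mul_pos (by omega) (sig_pos p a)
    have h3'' : 1024 * (k : ℝ) ≤ (p * sig p a : ℕ) * bits p := by exact_mod_cast h3'
    rw [one_div_mul_eq_div, div_le_div_iff₀ hm0 hkl]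
    have h4 := mul_log_two_le_of_isBits h0
    have h5 := mul_le_mul_of_nonneg_left h4 hm0.le
    have h6 := mul_le_mul_of_nonneg_right h3'' hl2.le
    linarith

def primesUnder (X : ℕ) : List ℕ := smallPrimes.filter fun p => Nat.blt p X

/-- The numerator of `σ(n) / n` for the part of the maximizer supported on small primes. -/
def numer (s : List ℕ) (X : ℕ) : ℕ := ((primesUnder X).map fun p => sig p (expo s p)).prod

def denom (s : List ℕ) (X : ℕ) : ℕ := ((primesUnder X).map fun p => p ^ expo s p).prod

theorem log_list_prod_map (l : List ℕ) (g : ℕ → ℕ) (hg : ∀ p ∈ l, 0 < g p) :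
    Real.log ((l.map g).prod : ℕ) = (l.map fun p => Real.log (g p)).sum := by
  induction l with
  | nil => simp
  | cons p l ih =>
    have hl : ∀ q ∈ l, 0 < g q := fun q hq => hg q (List.mem_cons_of_mem _ hq)
    have h0 : (l.map g).prod ≠ 0 := by
      rw [Ne, List.prod_eq_zero_iff]
      intro h
      obtain ⟨q, hq, hq0⟩ := List.mem_map.1 h
      exact (hl q hq).ne' hq0
    rw [List.map_cons, List.prod_cons, Nat.cast_mul, Real.log_mul, ih hl, List.map_cons,
      List.sum_cons]
    · exact_mod_cast (hg p List.mem_cons_self).ne'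
    · exact_mod_cast h0

theorem log_sum_divisors_le_of_certificate {k X r B : ℕ} (s : List ℕ) {R T : ℝ} (hk : 0 < k)
    (hkX : 2 ^ k ≤ X ^ X) (hX : 512 < X → X ^ X ≤ 2 ^ k) (hk' : k ≤ 2359296)
    (hopt : ((primesUnder X).all fun p => optimal k p (expo s p)) = true)
    (hr : 10 ^ 9 * numer s X ≤ r * denom s X) (hB : 2 ^ B ≤ denom s X ^ 64)
    (hR : RoughBound X R T) {N : ℕ} (hN : N ≠ 0)
    (hfree : ∀ p : ℕ, p.Prime → ¬ p ^ 7 ∣ N) :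
    Real.log ((∑ d ∈ N.divisors, d : ℕ) : ℝ) ≤ Real.log N + Real.log (r / 10 ^ 9 * R)
      + (Real.log N - (B / 64 + T) * Real.log 2) / (k * Real.log 2) := by
  have hl2 : 0 < Real.log 2 := Real.log_pos (by norm_num)
  have hk0 : (0 : ℝ) < k := by exact_mod_cast hk
  have hkl : 0 < k * Real.log 2 := by positivity
  have hX0 : 0 < X := by
    rcases Nat.eq_zero_or_pos X with h | h
    · subst h
      have : 2 ^ 1 ≤ 2 ^ k := Nat.pow_le_pow_right (by norm_num) hk
      omega
    · exact h
  have hkX' : k * Real.log 2 ≤ X * Real.log X := by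
    have := Real.log_le_log (by positivity) (show (2 : ℝ) ^ k ≤ (X : ℝ) ^ X by exact_mod_cast hkX)
    rwa [Real.log_pow, Real.log_pow] at this
  set l := 1 / (k * Real.log 2) with hl
  set E : ℕ → ℕ := fun p => if p < 512 then expo s p else 1 with hE
  set f : ℕ → ℝ := fun p => Real.log (sig p (E p)) - (1 + l) * (E p * Real.log p) with hf
  set S₀ := (primesUnder X).toFinset with hS₀
  have hmem : ∀ p ∈ primesUnder X, p ∈ smallPrimes ∧ p < X := fun p hp => by
    rw [primesUnder, List.mem_filter] at hp
    exact ⟨hp.1, by simpa [Nat.blt_eq] using hp.2⟩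
  have hlocal : ∀ p ∈ S₀ ∪ roughs X, 2 ≤ p ∧ ∀ c ≤ 6,
      Real.log (sig p c) - (1 + l) * (c * Real.log p) ≤ f p := by
    intro p hp
    rcases mem_union.1 hp with h | h
    · have hp' := List.mem_toFinset.1 h
      have hb := smallPrimes_bounds p (hmem p hp').1
      refine ⟨hb.1, fun c hc => ?_⟩
      have ho := List.all_eq_true.1 hopt p hp'
      simp only [hf, hE, if_pos hb.2]
      exact log_sig_sub_le_of_optimal hb.1 hk ho hc
    · obtain ⟨h512, hpX⟩ := mem_Ico.1 (mem_filter.1 h).1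
      have hp0 : (512 : ℝ) ≤ p := by exact_mod_cast h512
      refine ⟨by omega, fun c hc => ?_⟩
      have hXk : X * Real.log X ≤ k * Real.log 2 := by
        have := Real.log_le_log (by positivity)
          (show (X : ℝ) ^ X ≤ (2 : ℝ) ^ k by exact_mod_cast hX (by omega))
        rwa [Real.log_pow, Real.log_pow] at this
      have hpX' : (p : ℝ) + 1 ≤ X := by exact_mod_cast hpX
      have hlog9 : 9 * Real.log 2 ≤ Real.log p := by
        have := Real.log_le_log (by norm_num) (show (2 : ℝ) ^ 9 ≤ p by linarith)
        rw [Real.log_pow] at this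
        exact_mod_cast this
      have hlogX : Real.log p ≤ Real.log X := Real.log_le_log (by linarith) (by linarith)
      simp only [hf, hE, if_neg (show ¬ p < 512 by omega)]
      refine log_sig_sub_le_of_steps (by omega) (fun _ => ?_) (fun _ => ?_) hc
      · rw [Nat.sub_self, sig_zero, mul_one, hl, one_div_mul_eq_div,
          div_le_div_iff₀ hkl (by positivity)]
        nlinarith
      · have hm : (0 : ℝ) < (p * sig p 1 : ℕ) := by
          exact_mod_cast Nat.mul_pos (by omega) (sig_pos p 1)
        rw [hl, one_div_mul_eq_div, div_le_div_iff₀ hm hkl, sig_succ, sig_zero]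
        have hk2 : (k : ℝ) ≤ 2359296 := by exact_mod_cast hk'
        push_cast
        have e1 : 262144 * (9 * Real.log 2) ≤ ((p : ℝ) * (p * 1 + 1)) * Real.log p :=
          mul_le_mul (by nlinarith) hlog9 (by positivity) (by positivity)
        nlinarith
  have hf0 : ∀ p ∈ S₀ ∪ roughs X, 0 ≤ f p := by
    intro p hp
    simpa [sig_zero] using (hlocal p hp).2 0 (by norm_num)
  have hmain := log_sum_divisors_le hN hfree l (S₀ ∪ roughs X) f hf0 (by
    intro p a hp ha ha6
    split_ifs with hpS
    · exact (hlocal p hpS).2 a ha6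
    have hpX : X ≤ p := by
      by_contra! h
      refine hpS (mem_union.2 ?_)
      rcases Nat.lt_or_ge p 512 with h5 | h5
      · left
        rw [hS₀, List.mem_toFinset, primesUnder, List.mem_filter]
        exact ⟨mem_smallPrimes hp h5, by simpa [Nat.blt_eq] using h⟩
      · exact Or.inr (mem_filter.2 ⟨mem_Ico.2 ⟨h5, h⟩, rough_of_prime hp h5⟩)
    have hX0' : (0 : ℝ) < X := by exact_mod_cast hX0
    have hpX' : (X : ℝ) ≤ p := by exact_mod_cast hpX
    have h0 := log_sig_sub_le_of_steps (n := p) (a := 0) (c := a) (l := l) hp.two_le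
      (fun h => absurd h (by norm_num)) (fun _ => ?_) ha6
    · simpa [sig_zero] using h0
    rw [sig_zero, mul_one, hl, one_div_mul_eq_div, div_le_div_iff₀ (by linarith) hkl, one_mul]
    have e1 : Real.log X ≤ Real.log p := Real.log_le_log hX0' hpX'
    have e2 : 0 ≤ Real.log X := Real.log_natCast_nonneg X
    nlinarith)
  have hdis : Disjoint S₀ (roughs X) := by
    refine Finset.disjoint_left.2 fun p h1 h2 => ?_
    have e1 := (smallPrimes_bounds p (hmem p (List.mem_toFinset.1 h1)).1).2
    have e2 := (mem_Ico.1 (mem_filter.1 h2).1).1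
    omega
  have hnodup : (primesUnder X).Nodup := smallPrimes_nodup.filter _
  have hsmall : ∑ p ∈ S₀, f p = Real.log (numer s X) - (1 + l) * Real.log (denom s X) := by
    have e1 : Real.log (numer s X) = ∑ p ∈ S₀, Real.log (sig p (expo s p)) := by
      rw [numer, log_list_prod_map _ _ fun p _ => sig_pos _ _, hS₀,
        List.sum_toFinset _ hnodup]
    have e2 : Real.log (denom s X) = ∑ p ∈ S₀, expo s p * Real.log p := by
      rw [denom, log_list_prod_map _ _ fun p hp => ?_, hS₀, List.sum_toFinset _ hnodup]
      · simp only [Nat.cast_pow, Real.log_pow]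
      · have := (smallPrimes_bounds p (hmem p hp).1).1
        positivity
    rw [e1, e2, Finset.mul_sum, ← Finset.sum_sub_distrib]
    refine Finset.sum_congr rfl fun p hp => ?_
    have hb := smallPrimes_bounds p (hmem p (List.mem_toFinset.1 hp)).1
    simp only [hf, hE, if_pos hb.2]
  have hlarge : ∑ p ∈ roughs X, f p
      = ∑ n ∈ roughs X, (Real.log (n + 1 : ℕ) - Real.log n) - l * ∑ n ∈ roughs X, Real.log n := by
    rw [Finset.mul_sum, ← Finset.sum_sub_distrib]
    refine Finset.sum_congr rfl fun p hp => ?_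
    have h512 := (mem_Ico.1 (mem_filter.1 hp).1).1
    simp only [hf, hE, if_neg (show ¬ p < 512 by omega)]
    rw [sig_succ, sig_zero, mul_one, Nat.cast_one]
    ring
  have hden : 0 < denom s X := by
    rcases Nat.eq_zero_or_pos (denom s X) with h | h
    · rw [h] at hB
      have : 0 < 2 ^ B := by positivity
      simp at hB
    · exact h
  have hnum : 0 < numer s X := by
    rw [numer]
    refine Nat.pos_of_ne_zero fun h => ?_
    rw [List.prod_eq_zero_iff] at h
    obtain ⟨q, _, hq0⟩ := List.mem_map.1 h
    exact (sig_pos _ _).ne' hq0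
  have hr0 : 0 < r := by
    rcases Nat.eq_zero_or_pos r with h0 | h0
    · rw [h0, zero_mul] at hr
      have : 0 < 10 ^ 9 * numer s X := by positivity
      omega
    · exact h0
  have hsz : B / 64 * Real.log 2 ≤ Real.log (denom s X) := by
    have := Real.log_le_log (by positivity)
      (show (2 : ℝ) ^ B ≤ (denom s X : ℝ) ^ 64 by exact_mod_cast hB)
    rw [Real.log_pow, Real.log_pow] at this
    push_cast at this
    linarith
  have hrat : Real.log (numer s X) - Real.log (denom s X) ≤ Real.log (r / 10 ^ 9) := by
    rw [← Real.log_div (by positivity) (by positivity)]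
    refine Real.log_le_log (by positivity) ?_
    rw [div_le_div_iff₀ (by positivity) (by positivity), mul_comm]
    exact_mod_cast hr
  have hl0 : 0 < l := by positivity
  have hR0 := hR.pos
  have hR1 := hR.ratio
  have hR2 := hR.size
  rw [Finset.sum_union hdis, hsmall, hlarge] at hmain
  have e3 : (Real.log N - (B / 64 + T) * Real.log 2) / (k * Real.log 2)
      = l * (Real.log N - (B / 64 + T) * Real.log 2) := by
    rw [hl, one_div_mul_eq_div]
  rw [Real.log_mul (by positivity) hR0.ne', e3]
  have e1 := mul_le_mul_of_nonneg_left hsz hl0.le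
  have e2 := mul_le_mul_of_nonneg_left hR2 hl0.le
  nlinarith

set_option maxRecDepth 100000

theorem roughBound_10 : RoughBound (2 ^ 10) (1106592879 / 10 ^ 9) 716 :=
  ((roughBound_of_le (X := 2 ^ 9) (by norm_num)).step (by norm_num) 1106592879 716 (by decide +kernel)
    (by decide +kernel)).mono (by norm_num) (by norm_num)

theorem roughBound_11 : RoughBound (2 ^ 11) (1214886874 / 10 ^ 9) 2160 :=
  (roughBound_10.step (by norm_num) 1097862544 1444 (by decide +kernel)
    (by decide +kernel)).mono (by norm_num) (by norm_num)

theorem roughBound_12 : RoughBound (2 ^ 12) (1324805074 / 10 ^ 9) 5105 :=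
  (roughBound_11.step (by norm_num) 1090476078 2945 (by decide +kernel)
    (by decide +kernel)).mono (by norm_num) (by norm_num)

theorem roughBound_13 : RoughBound (2 ^ 13) (1433467150 / 10 ^ 9) 10928 :=
  (roughBound_12.step (by norm_num) 1082021180 5823 (by decide +kernel)
    (by decide +kernel)).mono (by norm_num) (by norm_num)

theorem roughBound_14 : RoughBound (2 ^ 14) (1543697563 / 10 ^ 9) 22745 :=
  (roughBound_13.step (by norm_num) 1076897760 11817 (by decide +kernel)
    (by decide +kernel)).mono (by norm_num) (by norm_num)

theorem roughBound_15 : RoughBound (2 ^ 15) (1653051693 / 10 ^ 9) 46202 :=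
  (roughBound_14.step (by norm_num) 1070839089 23457 (by decide +kernel)
    (by decide +kernel)).mono (by norm_num) (by norm_num)

theorem roughBound_16 : RoughBound (2 ^ 16) (1763022622 / 10 ^ 9) 93319 :=
  (roughBound_15.step (by norm_num) 1066526007 47117 (by decide +kernel)
    (by decide +kernel)).mono (by norm_num) (by norm_num)

theorem eulerMascheroniConstant_gt : 0.57719 < Real.eulerMascheroniConstant := by
  have h := harm_le (m := 64) (by norm_num)
  have h64 : Real.log (64 : ℕ) = 6 * Real.log 2 := by
    rw [show ((64 : ℕ) : ℝ) = 2 ^ 6 by norm_num, Real.log_pow]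
    norm_num
  have h2 := Real.log_two_lt_d9
  have hs : (4.743890 : ℝ) < harm 64 := by
    norm_num [harm, Finset.sum_Ioc_succ_top]
  rw [h64] at h
  norm_num at h hs ⊢
  linarith

theorem exp_eulerMascheroniConstant_gt : 1.781 < Real.exp Real.eulerMascheroniConstant := by
  have h1 : Real.exp 0.57719 < Real.exp Real.eulerMascheroniConstant :=
    Real.exp_lt_exp.2 eulerMascheroniConstant_gt
  refine lt_of_le_of_lt ?_ h1
  refine le_trans ?_ (Real.sum_le_exp_of_nonneg (by norm_num) 10)
  norm_num [Finset.sum_range_succ, Nat.factorial]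

theorem mul_log_two_le_log {x : ℝ} {a b : ℕ} (ha : 0 < a) (h : (2 : ℝ) ^ b ≤ x ^ a) :
    (b / a : ℝ) * Real.log 2 ≤ Real.log x := by
  have := Real.log_le_log (by positivity) h
  rw [Real.log_pow, Real.log_pow] at this
  have ha' : (0 : ℝ) < a := by exact_mod_cast ha
  rw [div_mul_eq_mul_div, div_le_iff₀ ha']
  linarith

theorem mul_log_two_le_log_mul_two_pow (j : ℕ) :
    (j + 33 / 68) * Real.log 2 ≤ Real.log (7 / 5 * 2 ^ j) := by
  have h : ((33 : ℕ) / (68 : ℕ) : ℝ) * Real.log 2 ≤ Real.log (7 / 5) :=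
    mul_log_two_le_log (by norm_num) (by norm_num)
  rw [Real.log_mul (by norm_num) (by positivity), Real.log_pow]
  push_cast at h
  linarith

/-- At `log N = L` the majorant of `log (σ(N) / N)` given by `log Q` and `Θ` is below
the logarithm of Robin's bound. -/
def Below (k : ℕ) (Q Θ L : ℝ) : Prop :=
  Real.log Q + (L - Θ * Real.log 2) / (k * Real.log 2)
    < Real.eulerMascheroniConstant + Real.log (Real.log L)

theorem exp_le_taylor {z : ℝ} (hz : |z| ≤ 1) :
    Real.exp z ≤ 1 + z + z ^ 2 / 2 + z ^ 3 / 6 + 5 * z ^ 4 / 96 := by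
  have := (abs_le.1 (Real.exp_bound hz (n := 4) (by norm_num))).2
  rw [show |z| ^ 4 = z ^ 4 from (by norm_num : Even 4).pow_abs z] at this
  norm_num [Finset.sum_range_succ, Nat.factorial] at this
  linarith

theorem exp_natCast_add_le (m : ℕ) {z c : ℝ} (hz : |z| ≤ 1)
    (h : 2.7182818286 ^ m * (1 + z + z ^ 2 / 2 + z ^ 3 / 6 + 5 * z ^ 4 / 96) ≤ c) :
    Real.exp (m + z) ≤ c := by
  have h1 : Real.exp m ≤ 2.7182818286 ^ m := by
    rw [← Real.exp_one_pow]
    exact pow_le_pow_left₀ (Real.exp_pos 1).le Real.exp_one_lt_d9.le m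
  rw [Real.exp_add]
  exact (mul_le_mul h1 (exp_le_taylor hz) (Real.exp_pos z).le (by positivity)).trans h

theorem Below.of_le {k : ℕ} {Q Θ L w : ℝ} (z : ℝ) (hk : 0 < k) (hQ : 0 < Q) (hL : 0 < L)
    (hw : 0 < w) (hwL : w * Real.log 2 ≤ Real.log L)
    (hz : L / (k * 0.6931471803) - Θ / k ≤ z) (hz1 : |z| ≤ 1)
    (h : Q * (1 + z + z ^ 2 / 2 + z ^ 3 / 6 + 5 * z ^ 4 / 96) < 1.781 * (w * 0.6931471803)) :
    Below k Q Θ L := by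
  have h2 := Real.log_two_gt_d9
  have hl2 : 0 < Real.log 2 := Real.log_pos (by norm_num)
  have hk0 : (0 : ℝ) < k := by exact_mod_cast hk
  have e1 : (L - Θ * Real.log 2) / (k * Real.log 2) = L / (k * Real.log 2) - Θ / k := by
    field_simp
  have e2 : L / (k * Real.log 2) ≤ L / (k * 0.6931471803) :=
    div_le_div_of_nonneg_left hL.le (by positivity) (by nlinarith)
  have hlog : 0 < Real.log L := lt_of_lt_of_le (by positivity) hwL
  have e4 : Q * Real.exp z < Real.exp Real.eulerMascheroniConstant * Real.log L := by
    calc Q * Real.exp z ≤ _ := mul_le_mul_of_nonneg_left (exp_le_taylor hz1) hQ.le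
      _ < _ := h
      _ ≤ 1.781 * Real.log L := by
        refine mul_le_mul_of_nonneg_left (le_trans ?_ hwL) (by norm_num)
        exact mul_le_mul_of_nonneg_left h2.le hw.le
      _ ≤ _ := mul_le_mul_of_nonneg_right exp_eulerMascheroniConstant_gt.le hlog.le
  have e5 := Real.log_lt_log (by positivity) e4
  rw [Real.log_mul hQ.ne' (Real.exp_pos _).ne', Real.log_mul (Real.exp_pos _).ne' hlog.ne',
    Real.log_exp, Real.log_exp] at e5
  rw [Below, e1]
  linarith

theorem concaveOn_log_log : ConcaveOn ℝ (Set.Ioi 1) fun x => Real.log (Real.log x) := by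
  have h1 : ConcaveOn ℝ (Set.Ioi 1) Real.log :=
    strictConcaveOn_log_Ioi.concaveOn.subset (Set.Ioi_subset_Ioi zero_le_one) (convex_Ioi 1)
  refine ⟨convex_Ioi 1, fun x hx y hy a b ha hb hab => ?_⟩
  have hx' : 0 < Real.log x := Real.log_pos hx
  have hy' : 0 < Real.log y := Real.log_pos hy
  have hc : 0 < a • Real.log x + b • Real.log y :=
    (convex_Ioi (0 : ℝ)) hx' hy' ha hb hab
  exact (strictConcaveOn_log_Ioi.concaveOn.2 hx' hy' ha hb hab).trans
    (Real.log_le_log hc (h1.2 hx hy ha hb hab))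

theorem Below.of_mem_Icc {k : ℕ} {Q Θ L₁ L₂ L : ℝ} (h₁ : Below k Q Θ L₁) (h₂ : Below k Q Θ L₂)
    (hL₁ : 1 < L₁) (hL : L ∈ Set.Icc L₁ L₂) : Below k Q Θ L := by
  have hseg : L ∈ segment ℝ L₁ L₂ := by
    rw [segment_eq_Icc (hL.1.trans hL.2)]
    exact hL
  obtain ⟨a, b, ha, hb, hab, rfl⟩ := hseg
  have hc := concaveOn_log_log.2 hL₁ (lt_of_lt_of_le hL₁ (hL.1.trans hL.2)) ha hb hab
  simp only [Below, smul_eq_mul] at *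
  obtain rfl : b = 1 - a := by linarith
  set M := k * Real.log 2
  have e : (a * L₁ + (1 - a) * L₂ - Θ * Real.log 2) / M
      = a * ((L₁ - Θ * Real.log 2) / M) + (1 - a) * ((L₂ - Θ * Real.log 2) / M) := by ring
  rw [e]
  rcases ha.eq_or_lt with rfl | ha'
  · simp only [zero_mul, zero_add, sub_zero, one_mul] at *
    linarith
  · nlinarith [mul_lt_mul_of_pos_left h₁ ha', mul_le_mul_of_nonneg_left h₂.le hb]

/-- Robin's inequality on the range `7 / 5 * 2 ^ j ≤ log N ≤ 7 / 5 * 2 ^ (j + 1)` from a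
certificate for the parameter `1 / (k log 2)` with `k = (j + 1) * 2 ^ (j + 1)`. -/
theorem log_sum_divisors_lt_of_certificate {j r B : ℕ} (s : List ℕ) {R T : ℝ} (z₁ z₂ : ℝ)
    (hj : (j + 1) * 2 ^ (j + 1) ≤ 2359296)
    (hopt : ((primesUnder (2 ^ (j + 1))).all fun p =>
      optimal ((j + 1) * 2 ^ (j + 1)) p (expo s p)) = true)
    (hr : 10 ^ 9 * numer s (2 ^ (j + 1)) ≤ r * denom s (2 ^ (j + 1)))
    (hB : 2 ^ B ≤ denom s (2 ^ (j + 1)) ^ 64)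
    (hR : RoughBound (2 ^ (j + 1)) R T) (hr0 : 0 < r)
    (h : |z₁| ≤ 1 ∧ |z₂| ≤ 1 ∧
      7 / 5 * 2 ^ j / (((j + 1) * 2 ^ (j + 1) : ℕ) * 0.6931471803)
        - (B / 64 + T) / ((j + 1) * 2 ^ (j + 1) : ℕ) ≤ z₁ ∧
      7 / 5 * 2 ^ (j + 1) / (((j + 1) * 2 ^ (j + 1) : ℕ) * 0.6931471803)
        - (B / 64 + T) / ((j + 1) * 2 ^ (j + 1) : ℕ) ≤ z₂ ∧
      r / 10 ^ 9 * R * (1 + z₁ + z₁ ^ 2 / 2 + z₁ ^ 3 / 6 + 5 * z₁ ^ 4 / 96)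
        < 1.781 * ((j + 33 / 68) * 0.6931471803) ∧
      r / 10 ^ 9 * R * (1 + z₂ + z₂ ^ 2 / 2 + z₂ ^ 3 / 6 + 5 * z₂ ^ 4 / 96)
        < 1.781 * ((j + 1 + 33 / 68) * 0.6931471803))
    {N : ℕ} (hN : N ≠ 0) (hfree : ∀ p : ℕ, p.Prime → ¬ p ^ 7 ∣ N)
    (hL : Real.log N ∈ Set.Icc (7 / 5 * 2 ^ j : ℝ) (7 / 5 * 2 ^ (j + 1))) :
    Real.log ((∑ d ∈ N.divisors, d : ℕ) : ℝ)
      < Real.eulerMascheroniConstant + Real.log N + Real.log (Real.log (Real.log N)) := by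
  obtain ⟨ha₁, ha₂, hz₁, hz₂, hp₁, hp₂⟩ := h
  have hk : 0 < (j + 1) * 2 ^ (j + 1) := by positivity
  have hXk : (2 ^ (j + 1)) ^ 2 ^ (j + 1) = 2 ^ ((j + 1) * 2 ^ (j + 1)) := (pow_mul _ _ _).symm
  have hc := log_sum_divisors_le_of_certificate s hk hXk.ge (fun _ => hXk.le) hj hopt hr hB hR
    hN hfree
  have hQ : 0 < r / 10 ^ 9 * R := mul_pos (by positivity) hR.pos
  have hw := mul_log_two_le_log_mul_two_pow j
  have hw' := mul_log_two_le_log_mul_two_pow (j + 1)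
  push_cast at hw'
  have b₁ := Below.of_le z₁ hk hQ (by positivity) (by positivity) hw hz₁ ha₁ hp₁
  have b₂ := Below.of_le z₂ hk hQ (by positivity) (by positivity) hw' hz₂ ha₂ hp₂
  have h1 : (1 : ℝ) ≤ 2 ^ j := one_le_pow₀ (by norm_num)
  have hb := b₁.of_mem_Icc b₂ (by linarith) hL
  rw [Below] at hb
  linarith

/-- Robin's inequality holds for every 7-free `N` with `a ≤ log N ≤ b`. -/
def RobinOn (a b : ℝ) : Prop :=
  ∀ N : ℕ, N ≠ 0 → (∀ p : ℕ, p.Prime → ¬ p ^ 7 ∣ N) → Real.log N ∈ Set.Icc a b →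
    Real.log ((∑ d ∈ N.divisors, d : ℕ) : ℝ)
      < Real.eulerMascheroniConstant + Real.log N + Real.log (Real.log (Real.log N))

theorem RobinOn.trans {a b c : ℝ} (h : RobinOn a b) (h' : RobinOn b c) : RobinOn a c :=
  fun N hN hfree hL => (le_total (Real.log N) b).elim (fun e => h N hN hfree ⟨hL.1, e⟩)
    fun e => h' N hN hfree ⟨e, hL.2⟩

theorem robinOn_first : RobinOn (37 / 4) (7 / 5 * 2 ^ 3) := by
  intro N hN hfree hL
  have hc := log_sum_divisors_le_of_certificate (k := 43) (X := 12) (r := 4187012988) (B := 1008)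
    [12, 4, 3, 3] (by norm_num) (by norm_num) (by norm_num) (by norm_num) (by decide +kernel)
    (by decide +kernel) (by decide +kernel) (roughBound_of_le (by norm_num)) hN hfree
  have hw : ((138 : ℕ) / (43 : ℕ) : ℝ) * Real.log 2 ≤ Real.log (37 / 4) :=
    mul_log_two_le_log (by norm_num) (by norm_num)
  have b₁ := Below.of_le (k := 43) (Q := (4187012988 : ℕ) / 10 ^ 9 * 1) (Θ := (1008 : ℕ) / 64 + 0)
    (-55931 / 1000000) (by norm_num) (by norm_num) (by norm_num) (by norm_num) hw (by norm_num)
    (by norm_num [abs_le]) (by norm_num)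
  have b₂ := Below.of_le (k := 43) (Q := (4187012988 : ℕ) / 10 ^ 9 * 1) (Θ := (1008 : ℕ) / 64 + 0)
    (9493 / 1000000) (by norm_num) (by norm_num) (by norm_num) (by norm_num)
    (mul_log_two_le_log_mul_two_pow 3) (by norm_num) (by norm_num [abs_le]) (by norm_num)
  have hb := b₁.of_mem_Icc b₂ (by norm_num) hL
  rw [Below] at hb
  linarith

theorem robinOn_4 : RobinOn (7 / 5 * 2 ^ 3) (7 / 5 * 2 ^ 4) := fun _ =>
  log_sum_divisors_lt_of_certificate (r := 4699300700) (B := 1410) [16, 4, 4, 3, 3]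
    (-45883 / 500000) (32141 / 200000) (by norm_num) (by decide +kernel) (by decide +kernel)
    (by decide +kernel) (roughBound_of_le (by norm_num)) (by norm_num) (by norm_num [abs_le])

theorem robinOn_5 : RobinOn (7 / 5 * 2 ^ 4) (7 / 5 * 2 ^ 5) := fun _ =>
  log_sum_divisors_lt_of_certificate (r := 6187120931) (B := 3254) [32, 8, 4, 3, 3, 3]
    (-28949 / 250000) (43091 / 500000) (by norm_num) (by decide +kernel) (by decide +kernel)
    (by decide +kernel) (roughBound_of_le (by norm_num)) (by norm_num) (by norm_num [abs_le])

theorem robinOn_6 : RobinOn (7 / 5 * 2 ^ 5) (7 / 5 * 2 ^ 6) := fun _ =>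
  log_sum_divisors_lt_of_certificate (r := 7270085512) (B := 6005) [64, 8, 6, 4, 3, 3]
    (-76029 / 1000000) (18457 / 200000) (by norm_num) (by decide +kernel) (by decide +kernel)
    (by decide +kernel) (roughBound_of_le (by norm_num)) (by norm_num) (by norm_num [abs_le])

theorem robinOn_7 : RobinOn (7 / 5 * 2 ^ 6) (7 / 5 * 2 ^ 7) := fun _ =>
  log_sum_divisors_lt_of_certificate (r := 8521057076) (B := 11994) [128, 14, 6, 4, 4, 3]
    (-64889 / 1000000) (79381 / 1000000) (by norm_num) (by decide +kernel) (by decide +kernel)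
    (by decide +kernel) (roughBound_of_le (by norm_num)) (by norm_num) (by norm_num [abs_le])

theorem robinOn_8 : RobinOn (7 / 5 * 2 ^ 7) (7 / 5 * 2 ^ 8) := fun _ =>
  log_sum_divisors_lt_of_certificate (r := 9764393782) (B := 24056) [256, 20, 8, 6, 4, 4]
    (-3581 / 62500) (68939 / 1000000) (by norm_num) (by decide +kernel) (by decide +kernel)
    (by decide +kernel) (roughBound_of_le (by norm_num)) (by norm_num) (by norm_num [abs_le])

theorem robinOn_9 : RobinOn (7 / 5 * 2 ^ 8) (7 / 5 * 2 ^ 9) := fun _ =>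
  log_sum_divisors_lt_of_certificate (r := 11007297014) (B := 48191) [512, 30, 8, 6, 4, 4]
    (-25599 / 500000) (15253 / 250000) (by norm_num) (by decide +kernel) (by decide +kernel)
    (by decide +kernel) (roughBound_of_le (by norm_num)) (by norm_num) (by norm_num [abs_le])

theorem robinOn_10 : RobinOn (7 / 5 * 2 ^ 9) (7 / 5 * 2 ^ 10) := fun _ =>
  log_sum_divisors_lt_of_certificate (r := 11051588673) (B := 49970) [512, 42, 14, 8, 6, 4]
    (-45181 / 1000000) (872 / 15625) (by norm_num) (by decide +kernel) (by decide +kernel)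
    (by decide +kernel) roughBound_10 (by norm_num) (by norm_num [abs_le])

theorem robinOn_11 : RobinOn (7 / 5 * 2 ^ 10) (7 / 5 * 2 ^ 11) := fun _ =>
  log_sum_divisors_lt_of_certificate (r := 11074370896) (B := 52057) [512, 62, 18, 8, 6, 4]
    (-20089 / 500000) (5163 / 100000) (by norm_num) (by decide +kernel) (by decide +kernel)
    (by decide +kernel) roughBound_11 (by norm_num) (by norm_num [abs_le])

theorem robinOn_12 : RobinOn (7 / 5 * 2 ^ 11) (7 / 5 * 2 ^ 12) := fun _ =>
  log_sum_divisors_lt_of_certificate (r := 11086461115) (B := 54467) [512, 84, 20, 8, 6, 6]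
    (-18509 / 500000) (47139 / 1000000) (by norm_num) (by decide +kernel) (by decide +kernel)
    (by decide +kernel) roughBound_12 (by norm_num) (by norm_num [abs_le])

theorem robinOn_13 : RobinOn (7 / 5 * 2 ^ 12) (7 / 5 * 2 ^ 13) := fun _ =>
  log_sum_divisors_lt_of_certificate (r := 11095996358) (B := 58150) [512, 114, 24, 12, 8, 6]
    (-16731 / 500000) (22111 / 500000) (by norm_num) (by decide +kernel) (by decide +kernel)
    (by decide +kernel) roughBound_13 (by norm_num) (by norm_num [abs_le])

theorem robinOn_14 : RobinOn (7 / 5 * 2 ^ 13) (7 / 5 * 2 ^ 14) := fun _ =>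
  log_sum_divisors_lt_of_certificate (r := 11102244123) (B := 63633) [512, 174, 32, 14, 8, 6]
    (-98 / 3125) (1631 / 40000) (by norm_num) (by decide +kernel) (by decide +kernel)
    (by decide +kernel) roughBound_14 (by norm_num) (by norm_num [abs_le])

theorem robinOn_15 : RobinOn (7 / 5 * 2 ^ 14) (7 / 5 * 2 ^ 15) := fun _ =>
  log_sum_divisors_lt_of_certificate (r := 11106285365) (B := 71515) [512, 242, 44, 18, 8, 8]
    (-5789 / 200000) (1919 / 50000) (by norm_num) (by decide +kernel) (by decide +kernel)
    (by decide +kernel) roughBound_15 (by norm_num) (by norm_num [abs_le])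

theorem robinOn_16 : RobinOn (7 / 5 * 2 ^ 15) (7 / 5 * 2 ^ 16) := fun _ =>
  log_sum_divisors_lt_of_certificate (r := 11108801653) (B := 81662) [512, 350, 54, 20, 12, 8]
    (-13547 / 500000) (4503 / 125000) (by norm_num) (by decide +kernel) (by decide +kernel)
    (by decide +kernel) roughBound_16 (by norm_num) (by norm_num [abs_le])

theorem robinOn_all : RobinOn (37 / 4) (7 / 5 * 2 ^ 16) :=
  robinOn_first
  |>.trans robinOn_4 |>.trans robinOn_5 |>.trans robinOn_6 |>.trans robinOn_7 |>.trans robinOn_8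
  |>.trans robinOn_9 |>.trans robinOn_10 |>.trans robinOn_11 |>.trans robinOn_12 |>.trans robinOn_13
  |>.trans robinOn_14 |>.trans robinOn_15 |>.trans robinOn_16

/-- The sum of the divisors of `n` up to `m` and of their cofactors, written for fast evaluation. -/
def divisorSumUpTo (n m : ℕ) : ℕ :=
  Nat.rec 0 (fun d r => bif Nat.beq (Nat.mod n (Nat.succ d)) 0 then
    Nat.add (Nat.add (Nat.succ d) (Nat.div n (Nat.succ d))) r else r) m

theorem divisorSumUpTo_succ (n d : ℕ) : divisorSumUpTo n (d + 1) =
    if d + 1 ∣ n then d + 1 + n / (d + 1) + divisorSumUpTo n d else divisorSumUpTo n d := by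
  have h : divisorSumUpTo n (d + 1) = bif Nat.beq (n % (d + 1)) 0 then
    d + 1 + n / (d + 1) + divisorSumUpTo n d else divisorSumUpTo n d := rfl
  rw [h]
  split_ifs with hd
  · rw [Nat.mod_eq_zero_of_dvd hd]
    rfl
  · have hb : Nat.beq (n % (d + 1)) 0 = false :=
      Bool.eq_false_iff.2 fun e => hd (Nat.dvd_of_mod_eq_zero (Nat.eq_of_beq_eq_true e))
    rw [hb]
    rfl

theorem divisorSumUpTo_eq (n m : ℕ) :
    divisorSumUpTo n m = ∑ d ∈ (Icc 1 m).filter (· ∣ n), (d + n / d) := by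
  induction m with
  | zero => rfl
  | succ m ih =>
    rw [divisorSumUpTo_succ, ih, Finset.sum_filter, Finset.sum_filter,
      Finset.sum_Icc_succ_top (by omega)]
    split_ifs <;> omega

theorem sum_divisors_le_divisorSumUpTo {n m : ℕ} (hn : 0 < n) (hm : n < (m + 1) ^ 2) :
    ∑ d ∈ n.divisors, d ≤ divisorSumUpTo n m := by
  classical
  rw [divisorSumUpTo_eq, Finset.sum_add_distrib]
  set D := (Icc 1 m).filter (· ∣ n) with hD
  have hsub : n.divisors ⊆ D ∪ D.image (n / ·) := by
    intro d hd
    have hdn := Nat.dvd_of_mem_divisors hd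
    have hd0 : 0 < d := Nat.pos_of_mem_divisors hd
    rcases Nat.lt_or_ge m d with h | h
    · refine mem_union_right _ (mem_image.2 ⟨n / d, ?_, Nat.div_div_self hdn hn.ne'⟩)
      have h1 : 0 < n / d := Nat.div_pos (Nat.le_of_dvd hn hdn) hd0
      have h2 : d * (n / d) = n := Nat.mul_div_cancel' hdn
      refine mem_filter.2 ⟨mem_Icc.2 ⟨h1, ?_⟩, Nat.div_dvd_of_dvd hdn⟩
      by_contra! hc
      nlinarith
    · exact mem_union_left _ (mem_filter.2 ⟨mem_Icc.2 ⟨hd0, h⟩, hdn⟩)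
  calc ∑ d ∈ n.divisors, d ≤ ∑ d ∈ D ∪ D.image (n / ·), d :=
        Finset.sum_le_sum_of_subset hsub
    _ ≤ ∑ d ∈ D, d + ∑ d ∈ D.image (n / ·), d := by
        rw [← Finset.sum_union_inter]
        exact Nat.le_add_right _ _
    _ ≤ _ := by
        gcongr
        exact Finset.sum_image_le_of_nonneg (fun _ _ => Nat.zero_le _)

theorem divisorSumUpTo_le_of_small : ∀ m < 32, ∀ i < 2 * (m + 71) + 1,
    Nat.ble (1000 * divisorSumUpTo ((m + 71) * (m + 71) + i) (m + 71))
      ((bif Nat.blt ((m + 71) * (m + 71) + i) 10080 then 3815 else 3950) *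
        ((m + 71) * (m + 71) + i)) = true := by
  decide +kernel

theorem sum_divisors_le_of_small {n : ℕ} (h : 5040 < n) (h' : n ≤ 10500) :
    1000 * ∑ d ∈ n.divisors, d ≤ (bif Nat.blt n 10080 then 3815 else 3950) * n := by
  have h1 : 71 ≤ n.sqrt := Nat.le_sqrt.2 (by omega)
  have h2 : n.sqrt < 103 := Nat.sqrt_lt.2 (by omega)
  obtain ⟨m, hm⟩ := Nat.exists_eq_add_of_le' h1
  obtain ⟨i, hi⟩ := Nat.exists_eq_add_of_le (Nat.sqrt_le n)
  have h3 := Nat.sqrt_le_add n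
  rw [hm] at hi h3
  have key := divisorSumUpTo_le_of_small m (by omega) i (by omega)
  rw [← hi, Nat.ble_eq] at key
  refine le_trans (Nat.mul_le_mul_left _ (sum_divisors_le_divisorSumUpTo (by omega) ?_)) key
  rw [← hm, sq]
  exact Nat.sqrt_lt.1 (Nat.lt_succ_self _)

theorem lt_exp_mul_log_log {L c w : ℝ} (hw : 0 < w) (hL : Real.exp w ≤ Real.log L)
    (h : c ≤ 1.781 * w) : c < Real.exp Real.eulerMascheroniConstant * Real.log (Real.log L) := by
  have h1 : w ≤ Real.log (Real.log L) := (Real.le_log_iff_exp_le ((Real.exp_pos w).trans_le hL)).2 hL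
  have h2 := exp_eulerMascheroniConstant_gt
  nlinarith [mul_pos (sub_pos.2 h2) hw]

theorem log_sum_divisors_lt_of_gt {N : ℕ} (hN : 10500 < N)
    (hfree : ∀ p : ℕ, p.Prime → ¬ p ^ 7 ∣ N) :
    Real.log ((∑ d ∈ N.divisors, d : ℕ) : ℝ)
      < Real.eulerMascheroniConstant + Real.log N + Real.log (Real.log (Real.log N)) := by
  rcases le_total (91750 : ℝ) (Real.log N) with h | h
  · exact log_sum_divisors_lt_of_large hfree h
  refine robinOn_all N (by omega) hfree ⟨?_, h.trans (by norm_num)⟩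
  have h1 : (10500 : ℝ) ≤ N := by exact_mod_cast hN.le
  refine (Real.le_log_iff_exp_le (by linarith)).2 (le_trans ?_ h1)
  rw [show (37 / 4 : ℝ) = (9 : ℕ) + 1 / 4 by norm_num]
  exact exp_natCast_add_le 9 (by norm_num [abs_le]) (by norm_num)

theorem sum_divisors_lt_of_le {N : ℕ} (h : 5040 < N) (h' : N ≤ 10500) :
    ((∑ d ∈ N.divisors, d : ℕ) : ℝ) <
      Real.exp Real.eulerMascheroniConstant * (N : ℝ) * Real.log (Real.log N) := by
  have hs := sum_divisors_le_of_small h h'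
  have h0 : (0 : ℝ) < N := by exact_mod_cast (show 0 < N by omega)
  suffices H : ∀ c : ℕ, 1000 * ∑ d ∈ N.divisors, d ≤ c * N →
      (c / 1000 : ℝ) < Real.exp Real.eulerMascheroniConstant * Real.log (Real.log N) →
      ((∑ d ∈ N.divisors, d : ℕ) : ℝ) <
        Real.exp Real.eulerMascheroniConstant * (N : ℝ) * Real.log (Real.log N) by
    rcases Nat.lt_or_ge N 10080 with h1 | h1
    · rw [show Nat.blt N 10080 = true by simpa using h1] at hs
      have h2 : (5041 : ℝ) ≤ N := by exact_mod_cast h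
      refine H 3815 hs (lt_exp_mul_log_log (w := 2.14207) (by norm_num) ?_ (by norm_num))
      refine (?_ : _ ≤ (8.52 : ℝ)).trans ((Real.le_log_iff_exp_le h0).2 (le_trans ?_ h2))
      · rw [show (2.14207 : ℝ) = (2 : ℕ) + 0.14207 by norm_num]
        exact exp_natCast_add_le 2 (by norm_num [abs_le]) (by norm_num)
      · rw [show (8.52 : ℝ) = (8 : ℕ) + 0.52 by norm_num]
        exact exp_natCast_add_le 8 (by norm_num [abs_le]) (by norm_num)
    · rw [show Nat.blt N 10080 = false by simpa [Bool.eq_false_iff] using h1] at hs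
      have h2 : (10080 : ℝ) ≤ N := by exact_mod_cast h1
      refine H 3950 hs (lt_exp_mul_log_log (w := 2.21787) (by norm_num) ?_ (by norm_num))
      refine (?_ : _ ≤ (9.19 : ℝ)).trans ((Real.le_log_iff_exp_le h0).2 (le_trans ?_ h2))
      · rw [show (2.21787 : ℝ) = (2 : ℕ) + 0.21787 by norm_num]
        exact exp_natCast_add_le 2 (by norm_num [abs_le]) (by norm_num)
      · rw [show (9.19 : ℝ) = (9 : ℕ) + 0.19 by norm_num]
        exact exp_natCast_add_le 9 (by norm_num [abs_le]) (by norm_num)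
  intro c hc hlt
  have hc' : (1000 : ℝ) * (∑ d ∈ N.divisors, d : ℕ) ≤ c * N := by exact_mod_cast hc
  have := mul_lt_mul_of_pos_right hlt h0
  linarith

end Robin

theorem robin_of_sevenfree (N : ℕ) (hN : 5040 < N)
    (hfree : ∀ p : ℕ, p.Prime → ¬ p ^ 7 ∣ N) :
    ((∑ d ∈ N.divisors, d : ℕ) : ℝ) <
      Real.exp Real.eulerMascheroniConstant * (N : ℝ) * Real.log (Real.log N) := by
  rcases Nat.lt_or_ge 10500 N with h | h
  swap
  · exact Robin.sum_divisors_lt_of_le hN h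
  have hlog := Robin.log_sum_divisors_lt_of_gt h hfree
  have hN0 : (0 : ℝ) < N := by exact_mod_cast (show 0 < N by omega)
  have hσ : (0 : ℝ) < (∑ d ∈ N.divisors, d : ℕ) := by
    exact_mod_cast Finset.sum_pos (fun d hd => Nat.pos_of_mem_divisors hd)
      ⟨1, Nat.one_mem_divisors.2 (by omega)⟩
  have h3 : (3 : ℝ) ≤ N := by exact_mod_cast (show 3 ≤ N by omega)
  have hll : 0 < Real.log (Real.log N) := by
    refine Real.log_pos ((Real.lt_log_iff_exp_lt hN0).2 ?_)
    linarith [Real.exp_one_lt_d9]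
  rw [← Real.log_lt_log_iff hσ (by positivity),
    Real.log_mul (by positivity) hll.ne', Real.log_mul (Real.exp_pos _).ne' hN0.ne', Real.log_exp]
  exact hlog
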